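/- arXiv:1403.1616 — 6 statements merged into one kernel-verified Lean document; each statement's English description precedes it below -/
import Mathlib

section
/- For every n ≥ 2, the ladder graph L_n is 2-word-representable but not 1-word-representable; hence its representation number R(L_n) equals 2. -/
/-- Two letters `x` and `y` alternate in the word `w` if, after deleting all letters
other than `x` and `y`, no two equal letters are consecutive. -/
def Alternate {V : Type*} [DecidableEq V] (w : List V) (x y : V) : Prop :=
  (w.filter (fun z => decide (z = x ∨ z = y))).Chain' (· ≠ ·)

/-- A word `w` represents the graph `G` if every vertex occurs in `w` and two distinct
vertices alternate in `w` exactly when they are adjacent in `G`. -/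
def Represents {V : Type*} [DecidableEq V] (w : List V) (G : SimpleGraph V) : Prop :=
  (∀ v : V, v ∈ w) ∧ ∀ x y : V, x ≠ y → (Alternate w x y ↔ G.Adj x y)

/-- A graph is word-representable if some word represents it. -/
def WordRepresentable {V : Type*} [DecidableEq V] (G : SimpleGraph V) : Prop :=
  ∃ w : List V, Represents w G

/-- A word is `k`-uniform if every letter occurs in it exactly `k` times. -/
def KUniform {V : Type*} [DecidableEq V] (k : ℕ) (w : List V) : Prop :=
  ∀ v : V, w.count v = k

/-- A graph is `k`-word-representable if some `k`-uniform word represents it. -/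
def KRepresentable {V : Type*} [DecidableEq V] (G : SimpleGraph V) (k : ℕ) : Prop :=
  ∃ w : List V, KUniform k w ∧ Represents w G

/-- The representation number of a graph: the least `k` such that it is
`k`-word-representable. -/
noncomputable def reprNum {V : Type*} [DecidableEq V] (G : SimpleGraph V) : ℕ :=
  sInf {k | KRepresentable G k}

/-- The ladder graph `L n` on the `2n` vertices `{1,…,n} ∪ {1',…,n'}`, with edges
`(i, i+1)`, `(i', (i+1)')` for `1 ≤ i ≤ n-1` and rungs `(i, i')` for `1 ≤ i ≤ n`.
Vertices `Sum.inl i` are the unprimed ones, `Sum.inr i` the primed ones. -/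
def ladder (n : ℕ) : SimpleGraph (Fin n ⊕ Fin n) :=
  SimpleGraph.fromRel (fun a b =>
    match a, b with
    | Sum.inl i, Sum.inl j => (i : ℕ) + 1 = (j : ℕ)
    | Sum.inr i, Sum.inr j => (i : ℕ) + 1 = (j : ℕ)
    | Sum.inl i, Sum.inr j => i = j
    | _, _ => False)

theorem alternate_iff_isChain {V : Type*} [DecidableEq V] (w : List V) (x y : V) :
    Alternate w x y ↔ (w.filter (fun z => decide (z = x ∨ z = y))).IsChain (· ≠ ·) :=
  Iff.rfl

theorem alternate_comm {V : Type*} [DecidableEq V] (w : List V) (x y : V) :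
    Alternate w x y ↔ Alternate w y x := by
  simp only [Alternate, or_comm]

/-- If the two occurrences of `p` enclose the factor `M` and `z` occurs twice, then `p` and `z`
alternate exactly when `z` occurs once in `M`. -/
theorem alternate_iff_count_eq_one {V : Type*} [DecidableEq V] {A M B : List V} {p z : V}
    (hz : z ≠ p) (hA : p ∉ A) (hM : p ∉ M) (hB : p ∉ B)
    (hcount : (A ++ p :: (M ++ p :: B)).count z = 2) :
    Alternate (A ++ p :: (M ++ p :: B)) p z ↔ M.count z = 1 := by
  have key : ∀ L : List V, p ∉ L →
      L.filter (fun c => decide (c = p ∨ c = z)) = List.replicate (L.count z) z := by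
    intro L hL
    rw [← List.filter_eq]
    refine List.filter_congr fun c hc => ?_
    have : c ≠ p := fun h => hL (h ▸ hc)
    simp [this, eq_comm]
  simp only [List.count_append, List.count_cons_of_ne hz.symm] at hcount
  rw [alternate_iff_isChain]
  simp only [List.filter_append, List.filter_cons, key A hA, key M hM, key B hB, true_or,
    decide_true, if_true]
  generalize A.count z = a at *
  generalize M.count z = m at *
  generalize B.count z = b at *
  have ha : a ≤ 2 := by omega
  have hm : m ≤ 2 := by omega
  obtain rfl : b = 2 - a - m := by omega
  interval_cases a <;> interval_cases m <;> simp_all [List.replicate, eq_comm]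

/-- The part of `twistedLadderWord n` before its central factor. -/
def twistedLadderPrefix : ℕ → List (ℕ × Bool)
  | 0 => []
  | n + 1 => twistedLadderPrefix n ++ [(n + 1, true), (n, false)]

/-- The part of `twistedLadderWord n` after its central factor. -/
def twistedLadderSuffix : ℕ → List (ℕ × Bool)
  | 0 => [(0, false), (0, true)]
  | n + 1 => (n, true) :: (n + 1, false) :: twistedLadderSuffix n

/-- A word in which two letters with indices at most `n` alternate exactly when they lie in
different classes and their indices differ by at most one. -/
def twistedLadderWord (n : ℕ) : List (ℕ × Bool) :=
  twistedLadderPrefix n ++ (n, false) :: (n, true) :: twistedLadderSuffix n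

theorem twistedLadderWord_succ (n : ℕ) :
    twistedLadderWord (n + 1) = twistedLadderPrefix n ++ (n + 1, true) ::
      ([(n, false), (n + 1, false)] ++ (n + 1, true) ::
        ((n, true) :: (n + 1, false) :: twistedLadderSuffix n)) := by
  simp [twistedLadderWord, twistedLadderPrefix, twistedLadderSuffix]

theorem twistedLadderWord_succ' (n : ℕ) :
    twistedLadderWord (n + 1) = (twistedLadderPrefix n ++ [(n + 1, true), (n, false)]) ++
      (n + 1, false) :: ([(n + 1, true), (n, true)] ++ (n + 1, false) ::
        twistedLadderSuffix n) := by
  simp [twistedLadderWord, twistedLadderPrefix, twistedLadderSuffix]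

theorem count_twistedLadderWord (n i : ℕ) (b : Bool) :
    @List.count _ instBEqOfDecidableEq (i, b) (twistedLadderWord n) = if i ≤ n then 2 else 0 := by
  induction n with
  | zero =>
    cases b <;> by_cases h : i = 0 <;>
      simp [twistedLadderWord, twistedLadderPrefix, twistedLadderSuffix, h, eq_comm]
  | succ n ih =>
    rw [twistedLadderWord_succ]
    simp only [twistedLadderWord, List.count_append, List.count_cons, beq_iff_eq,
      Prod.mk.injEq, List.count_nil] at ih ⊢
    cases b <;> simp at ih ⊢ <;> split_ifs at ih ⊢ <;> omega

theorem mem_twistedLadderWord {n i : ℕ} {b : Bool} :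
    (i, b) ∈ twistedLadderWord n ↔ i ≤ n := by
  rw [← @List.count_pos_iff _ instBEqOfDecidableEq, count_twistedLadderWord]
  split_ifs <;> simp_all

theorem not_mem_twistedLadder {n i : ℕ} (b : Bool) (h : n < i) :
    (i, b) ∉ twistedLadderPrefix n ∧ (i, b) ∉ twistedLadderSuffix n := by
  have : (i, b) ∉ twistedLadderWord n := mt mem_twistedLadderWord.1 (Nat.not_le.2 h)
  simp only [twistedLadderWord, List.mem_append, List.mem_cons] at this
  tauto

theorem alternate_twistedLadderWord_succ_true {n i : ℕ} {b : Bool} (hi : i ≤ n + 1)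
    (h : (i, b) ≠ (n + 1, true)) :
    Alternate (twistedLadderWord (n + 1)) (n + 1, true) (i, b) ↔ b = false ∧ n ≤ i := by
  have hc := count_twistedLadderWord (n + 1) i b
  have hmem := not_mem_twistedLadder true (Nat.lt_succ_self n)
  rw [if_pos hi] at hc
  rw [twistedLadderWord_succ] at hc ⊢
  rw [alternate_iff_count_eq_one h hmem.1 (by simp) (by simpa using hmem.2)]
  · cases b <;> simp [List.count_cons] <;> (try split_ifs); all_goals omega
  · exact hc

theorem alternate_twistedLadderWord_succ_false {n i : ℕ} {b : Bool} (hi : i ≤ n + 1)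
    (h : (i, b) ≠ (n + 1, false)) :
    Alternate (twistedLadderWord (n + 1)) (n + 1, false) (i, b) ↔ b = true ∧ n ≤ i := by
  have hc := count_twistedLadderWord (n + 1) i b
  have hmem := not_mem_twistedLadder false (Nat.lt_succ_self n)
  rw [if_pos hi] at hc
  rw [twistedLadderWord_succ'] at hc ⊢
  rw [alternate_iff_count_eq_one h (by simpa using hmem.1) (by simp) hmem.2]
  · cases b <;> simp [List.count_cons] <;> (try split_ifs); all_goals omega
  · exact hc

theorem alternate_twistedLadderWord_succ_self {n i : ℕ} {b : Bool} (c : Bool) (hi : i ≤ n + 1)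
    (h : (i, b) ≠ (n + 1, c)) :
    Alternate (twistedLadderWord (n + 1)) (n + 1, c) (i, b) ↔ b ≠ c ∧ n ≤ i := by
  cases c
  · simpa using alternate_twistedLadderWord_succ_false hi h
  · simpa using alternate_twistedLadderWord_succ_true hi h

theorem alternate_twistedLadderWord_succ_of_le {n i j : ℕ} (b c : Bool) (hi : i ≤ n)
    (hj : j ≤ n) : Alternate (twistedLadderWord (n + 1)) (i, b) (j, c) ↔
      Alternate (twistedLadderWord n) (i, b) (j, c) := by
  have hi' : n + 1 ≠ i := by omega
  have hj' : n + 1 ≠ j := by omega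
  rw [twistedLadderWord_succ]
  simp [Alternate, twistedLadderWord, List.filter_append, List.filter_cons, hi', hj']

theorem alternate_twistedLadderWord {n i j : ℕ} {b c : Bool} (hi : i ≤ n) (hj : j ≤ n)
    (h : (i, b) ≠ (j, c)) :
    Alternate (twistedLadderWord n) (i, b) (j, c) ↔ b ≠ c ∧ i ≤ j + 1 ∧ j ≤ i + 1 := by
  induction n with
  | zero =>
    obtain rfl : i = 0 := by omega
    obtain rfl : j = 0 := by omega
    cases b <;> cases c <;>
      simp_all [alternate_iff_isChain, twistedLadderWord, twistedLadderPrefix, twistedLadderSuffix]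
  | succ n ih =>
    rcases Nat.lt_or_ge n i with hni | hni
    · obtain rfl : i = n + 1 := by omega
      rw [alternate_twistedLadderWord_succ_self b hj h.symm]
      have : n ≤ j ↔ n + 1 ≤ j + 1 ∧ j ≤ n + 1 + 1 := by omega
      rw [this, ne_comm]
    · rcases Nat.lt_or_ge n j with hnj | hnj
      · obtain rfl : j = n + 1 := by omega
        rw [alternate_comm, alternate_twistedLadderWord_succ_self c hi h]
        have : n ≤ i ↔ i ≤ n + 1 + 1 ∧ n + 1 ≤ i + 1 := by omega
        rw [this]
      · rw [alternate_twistedLadderWord_succ_of_le b c hni hnj, ih hni hnj]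

theorem alternate_map_iff {V W : Type*} [DecidableEq V] [DecidableEq W] {f : V → W}
    (hf : f.Injective) (w : List V) (x y : V) :
    Alternate (w.map f) (f x) (f y) ↔ Alternate w x y := by
  simp [alternate_iff_isChain, List.filter_map, List.isChain_map, Function.comp_def, hf.eq_iff]

theorem kUniform_of_count_map {V W : Type*} [DecidableEq V] [DecidableEq W] {f : V → W}
    (hf : f.Injective) {k : ℕ} {w : List V} (h : ∀ v, (w.map f).count (f v) = k) :
    KUniform k w := fun v => by
  rw [← List.count_map_of_injective w f hf, h]

theorem KUniform.represents_of_alternate {V : Type*} [DecidableEq V] {G : SimpleGraph V} {k : ℕ}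
    (hk : k ≠ 0) {w : List V} (hw : KUniform k w)
    (h : ∀ x y, x ≠ y → (Alternate w x y ↔ G.Adj x y)) : Represents w G :=
  ⟨fun v => List.count_pos_iff.1 (by rw [hw v]; omega), h⟩

/-- The letters of `twistedLadderWord` corresponding to the vertices of the ladder: the two
classes are the colour classes of the bipartite ladder graph. -/
def ladderLetter (n : ℕ) : Fin n ⊕ Fin n → ℕ × Bool
  | Sum.inl i => (i, decide ((i : ℕ) % 2 = 1))
  | Sum.inr i => (i, decide ((i : ℕ) % 2 = 0))

theorem ladderLetter_injective (n : ℕ) : (ladderLetter n).Injective := by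
  rintro (i | i) (j | j) h <;>
    simp only [ladderLetter, Prod.mk.injEq, decide_eq_decide] at h
  · exact congrArg _ (Fin.ext h.1)
  · omega
  · omega
  · exact congrArg _ (Fin.ext h.1)

theorem mem_range_ladderLetter {n i : ℕ} (b : Bool) (hi : i < n) :
    (i, b) ∈ Set.range (ladderLetter n) := by
  by_cases h : b = decide (i % 2 = 1)
  · exact ⟨Sum.inl ⟨i, hi⟩, by simp [ladderLetter, h]⟩
  · refine ⟨Sum.inr ⟨i, hi⟩, ?_⟩
    rcases Nat.mod_two_eq_zero_or_one i with h2 | h2 <;> cases b <;> simp_all [ladderLetter]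

theorem ladder_adj_iff {n : ℕ} (x y : Fin n ⊕ Fin n) :
    (ladder n).Adj x y ↔ (ladderLetter n x).2 ≠ (ladderLetter n y).2 ∧
      (ladderLetter n x).1 ≤ (ladderLetter n y).1 + 1 ∧
      (ladderLetter n y).1 ≤ (ladderLetter n x).1 + 1 := by
  rcases x with i | i <;> rcases y with j | j <;>
    simp [ladder, SimpleGraph.fromRel_adj, ladderLetter, Fin.ext_iff] <;> omega

theorem kRepresentable_two_ladder {n : ℕ} (hn : 0 < n) : KRepresentable (ladder n) 2 := by
  obtain ⟨m, rfl⟩ : ∃ m, n = m + 1 := ⟨n - 1, by omega⟩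
  have hle : ∀ v, (ladderLetter (m + 1) v).1 ≤ m := by
    rintro (i | i) <;> exact Nat.lt_succ_iff.1 i.2
  have hinj := ladderLetter_injective (m + 1)
  obtain ⟨w, hw⟩ : twistedLadderWord m ∈ Set.range (List.map (ladderLetter (m + 1))) := by
    rw [Set.range_list_map]
    rintro ⟨i, b⟩ hmem
    exact mem_range_ladderLetter b (Nat.lt_succ_of_le (mem_twistedLadderWord.1 hmem))
  have huniform : KUniform 2 w := by
    refine kUniform_of_count_map hinj fun v => ?_
    rw [hw]
    rw [← Prod.mk.eta (p := ladderLetter (m + 1) v), count_twistedLadderWord, if_pos (hle v)]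
  refine ⟨w, huniform, huniform.represents_of_alternate two_ne_zero fun x y hxy => ?_⟩
  rw [← alternate_map_iff hinj, hw, ladder_adj_iff]
  exact alternate_twistedLadderWord (hle x) (hle y) (hinj.ne hxy)

theorem KRepresentable.ne_zero {V : Type*} [DecidableEq V] [Nonempty V] {G : SimpleGraph V}
    {k : ℕ} (h : KRepresentable G k) : k ≠ 0 := by
  obtain ⟨w, hw, hmem, -⟩ := h
  obtain ⟨v⟩ := ‹Nonempty V›
  rw [← hw v]
  exact (List.count_pos_iff.2 (hmem v)).ne'

/-- Only complete graphs are represented by words without repeated letters. -/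
theorem KRepresentable.eq_top {V : Type*} [DecidableEq V] {G : SimpleGraph V}
    (h : KRepresentable G 1) : G = ⊤ := by
  obtain ⟨w, hw, -, halt⟩ := h
  have hnodup : w.Nodup := List.nodup_iff_count_le_one.2 fun v => (hw v).le
  ext x y
  rw [SimpleGraph.top_adj]
  exact ⟨fun hadj => hadj.ne, fun hxy => (halt x y hxy).1 (hnodup.filter _).isChain⟩

theorem ladder_ne_top {n : ℕ} (hn : 2 ≤ n) : ladder n ≠ ⊤ := by
  intro h
  have : (ladder n).Adj (Sum.inl ⟨0, by omega⟩) (Sum.inr ⟨1, by omega⟩) := by simp [h]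
  simp [ladder] at this

/-- For every `n ≥ 2`, the ladder graph `L n` is 2-word-representable but not
1-word-representable; hence its representation number equals 2. -/
theorem ladder_representation_number_eq_two (n : ℕ) (hn : 2 ≤ n) :
    KRepresentable (ladder n) 2 ∧ ¬ KRepresentable (ladder n) 1 ∧
      reprNum (ladder n) = 2 := by
  have htwo : KRepresentable (ladder n) 2 := kRepresentable_two_ladder (by omega)
  have hone : ¬ KRepresentable (ladder n) 1 := fun h => ladder_ne_top hn h.eq_top
  refine ⟨htwo, hone, le_antisymm (Nat.sInf_le htwo) (le_csInf ⟨2, htwo⟩ fun k hk => ?_)⟩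
  have : Nonempty (Fin n ⊕ Fin n) := ⟨Sum.inl ⟨0, by omega⟩⟩
  have hk0 : k ≠ 0 := KRepresentable.ne_zero hk
  have hk1 : k ≠ 1 := fun h => hone (h ▸ hk)
  omega
end

section
/- Let G be a word-representable graph with representation number R(G) = 3, let x and y be vertices of G, and let H be the graph obtained from G by adding a path of length ℓ ≥ 3 connecting x and y, i.e., by adding ℓ−1 new vertices v1,…,v_{ℓ−1} together with the edges (x,v1), (v1,v2), …, (v_{ℓ−2},v_{ℓ−1}), (v_{ℓ−1},y). Then H is word-representable and R(H) = 3. -/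
namespace WordGraph

variable {W : Type*} [DecidableEq W]

/-- The word `w` represents, with three occurrences of each letter, the subgraph of `H`
induced on `S`. -/
structure RepresentsOn (H : SimpleGraph W) (S : Set W) (w : List W) : Prop where
  count_eq : ∀ v ∈ S, w.count v = 3
  notMem : ∀ v ∉ S, v ∉ w
  alternate_iff : ∀ a ∈ S, ∀ b ∈ S, a ≠ b → (Alternate w a b ↔ H.Adj a b)

theorem alternate_comm (w : List W) (a b : W) : Alternate w a b ↔ Alternate w b a := by
  simp only [Alternate, or_comm]

theorem not_alternate_of_repeat {w P M Q : List W} {a b : W}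
    (hw : w = P ++ a :: (M ++ a :: Q)) (hM : ∀ m ∈ M, m ≠ a ∧ m ≠ b) :
    ¬ Alternate w a b := by
  have hnil : M.filter (fun z => decide (z = a ∨ z = b)) = [] := by
    rw [List.filter_eq_nil_iff]
    intro m hm
    simpa using hM m hm
  subst hw
  change ¬ List.IsChain _ _
  simp only [List.filter_append, List.filter_cons, hnil]
  simp [List.isChain_append]

theorem alternate_filter_ne (w : List W) {a b u : W} (ha : a ≠ u) (hb : b ≠ u) :
    Alternate (w.filter (fun z => decide (z ≠ u))) a b ↔ Alternate w a b := by
  unfold Alternate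
  rw [List.filter_filter]
  have : (fun z => decide (z = a ∨ z = b) && decide (z ≠ u)) =
      (fun z => decide (z = a ∨ z = b)) := by
    funext z
    by_cases h1 : z = a
    · subst h1; simp [ha]
    · by_cases h2 : z = b
      · subst h2; simp [hb]
      · simp [h1, h2]
  rw [this]

theorem chain_extend (f : List W) : ∀ x y : W, x ≠ y → (∀ z ∈ f, z = x ∨ z = y) →
    (x :: f).IsChain (· ≠ ·) →
    (f.count x = f.count y ∧ (x :: f ++ [y]).IsChain (· ≠ ·)) ∨
      (f.count y = f.count x + 1 ∧ (x :: f ++ [x]).IsChain (· ≠ ·)) := by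
  induction f with
  | nil =>
    intro x y hxy _ _
    left
    simpa using hxy
  | cons b f ih =>
    intro x y hxy hf hc
    rw [List.isChain_cons_cons] at hc
    have hb : b = y := (hf b (by simp)).resolve_left (Ne.symm hc.1)
    subst hb
    rcases ih b x hxy.symm (fun z hz => (hf z (by simp [hz])).symm) hc.2 with h | h
    · right
      refine ⟨by simp [hxy.symm, h.1], ?_⟩
      rw [List.cons_append, List.cons_append, List.isChain_cons_cons]
      exact ⟨hc.1, h.2⟩
    · left
      refine ⟨by simp [hxy.symm, h.1], ?_⟩
      rw [List.cons_append, List.cons_append, List.isChain_cons_cons]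
      exact ⟨hc.1, h.2⟩

theorem chain_filter_rotate (w : List W) (x y : W) (hxy : x ≠ y)
    (hcount : (x :: w).count x = (x :: w).count y) (h : Alternate (x :: w) x y) :
    Alternate (w ++ [x]) x y := by
  unfold Alternate at h ⊢
  set p : W → Bool := fun z => decide (z = x ∨ z = y) with hp
  have hpx : p x = true := by simp [hp]
  have hpy : p y = true := by simp [hp]
  rw [List.filter_cons_of_pos hpx] at h
  have hx : (w.filter p).count x = w.count x := List.count_filter hpx
  have hy : (w.filter p).count y = w.count y := List.count_filter hpy
  have hc : w.count x + 1 = w.count y := by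
    simpa [List.count_cons, hxy] using hcount
  have hmem : ∀ z ∈ w.filter p, z = x ∨ z = y := by
    intro z hz
    simpa [hp] using (List.mem_filter.1 hz).2
  rcases chain_extend _ x y hxy hmem h with h' | h'
  · omega
  · rw [List.filter_append, List.filter_cons_of_pos hpx]
    exact h'.2.tail

theorem alternate_rotate_one (w : List W) (c x y : W) (hxy : x ≠ y)
    (hcount : (c :: w).count x = (c :: w).count y) (h : Alternate (c :: w) x y) :
    Alternate (w ++ [c]) x y := by
  by_cases hx : c = x
  · subst hx
    exact chain_filter_rotate w c y hxy hcount h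
  · by_cases hy : c = y
    · subst hy
      rw [alternate_comm] at h ⊢
      exact chain_filter_rotate w c x hxy.symm hcount.symm h
    · simpa [Alternate, hx, hy] using h

theorem alternate_append_swap (P : List W) : ∀ (Q : List W) (x y : W), x ≠ y →
    (P ++ Q).count x = (P ++ Q).count y → Alternate (P ++ Q) x y → Alternate (Q ++ P) x y := by
  induction P with
  | nil => intro Q x y _ _ h; simpa using h
  | cons c P ih =>
    intro Q x y hxy hc h
    have h1 := alternate_rotate_one (P ++ Q) c x y hxy hc h
    have h2 := ih (Q ++ [c]) x y hxy (by
      simp only [List.count_append, List.count_cons, List.cons_append] at hc ⊢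
      simp only [List.count_nil]
      omega) (by simpa using h1)
    simpa using h2

namespace RepresentsOn

variable {H : SimpleGraph W} {S : Set W}

theorem append_swap {P Q : List W} (h : RepresentsOn H S (P ++ Q)) :
    RepresentsOn H S (Q ++ P) := by
  have hcount : ∀ v ∈ S, (Q ++ P).count v = 3 := fun v hv => by
    rw [← h.count_eq v hv, List.count_append, List.count_append, add_comm]
  refine ⟨hcount, fun v hv => ?_, fun a ha b hb hab => ?_⟩
  · have := h.notMem v hv
    simp only [List.mem_append] at this ⊢
    tauto
  · rw [← h.alternate_iff a ha b hb hab]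
    constructor
    · exact alternate_append_swap Q P a b hab (by rw [hcount a ha, hcount b hb])
    · exact alternate_append_swap P Q a b hab (by rw [h.count_eq a ha, h.count_eq b hb])

theorem insert_letter {w w' : List W} {u : W} (h : RepresentsOn H S w)
    (hfilter : w'.filter (fun z => decide (z ≠ u)) = w) (hcount : w'.count u = 3)
    (hadj : ∀ z ∈ S, z ≠ u → (Alternate w' u z ↔ H.Adj u z)) :
    RepresentsOn H (insert u S) w' := by
  have hmem : ∀ v ∈ w', v ≠ u → v ∈ w := fun v hv hvu => by
    rw [← hfilter, List.mem_filter]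
    exact ⟨hv, by simpa using hvu⟩
  refine ⟨fun v hv => ?_, fun v hv hvw => ?_, fun a ha b hb hab => ?_⟩
  · by_cases hvu : v = u
    · rw [hvu, hcount]
    · rw [← h.count_eq v (hv.resolve_left hvu), ← hfilter, List.count_filter]
      simpa using hvu
  · rw [Set.mem_insert_iff, not_or] at hv
    exact h.notMem v hv.2 (hmem v hvw hv.1)
  · by_cases hau : a = u
    · subst hau
      exact hadj b (hb.resolve_left hab.symm) hab.symm
    · by_cases hbu : b = u
      · subst hbu
        rw [alternate_comm, H.adj_comm]
        exact hadj a (ha.resolve_left hab) hab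
      · rw [← alternate_filter_ne w' hau hbu, hfilter]
        exact h.alternate_iff a (ha.resolve_left hau) b (hb.resolve_left hbu) hab

theorem exists_split {w : List W} (h : RepresentsOn H S w) {x : W} (hx : x ∈ S) :
    ∃ A B C : List W, RepresentsOn H S (x :: A ++ x :: B ++ x :: C) ∧
      x ∉ A ∧ x ∉ B ∧ x ∉ C := by
  have hmem : x ∈ w := List.count_pos_iff.1 (by rw [h.count_eq x hx]; norm_num)
  obtain ⟨P, Q, rfl⟩ := List.append_of_mem hmem
  have h1 := h.append_swap
  rw [List.cons_append] at h1
  have hc := h1.count_eq x hx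
  rw [List.count_cons_self] at hc
  obtain ⟨A, R, hAR, hA⟩ := List.eq_append_cons_of_mem
    (List.count_pos_iff.1 (show 0 < (Q ++ P).count x by omega))
  rw [hAR] at h1 hc
  have hA0 := List.count_eq_zero.2 hA
  rw [List.count_append, List.count_cons_self] at hc
  obtain ⟨B, C, rfl, hB⟩ := List.eq_append_cons_of_mem
    (List.count_pos_iff.1 (show 0 < R.count x by omega))
  have hB0 := List.count_eq_zero.2 hB
  rw [List.count_append, List.count_cons_self] at hc
  exact ⟨A, B, C, by simpa using h1, hA, hB, List.count_eq_zero.1 (by omega)⟩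

theorem exists_split_pair {w : List W} (h : RepresentsOn H S w) {x y : W} (hx : x ∈ S)
    (hy : y ∈ S) (hxy : x ≠ y) :
    ∃ A B D C : List W, RepresentsOn H S (x :: A ++ x :: B ++ y :: D ++ x :: C) ∧
      x ∉ A ∧ x ∉ B ∧ x ∉ D ∧ x ∉ C ∧ A.count y + B.count y = 1 ∧
        D.count y + C.count y = 1 := by
  obtain ⟨A, B, C, h1, hA, hB, hC, hAy, hCy⟩ : ∃ A B C : List W,
      RepresentsOn H S (x :: A ++ x :: B ++ x :: C) ∧ x ∉ A ∧ x ∉ B ∧ x ∉ C ∧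
        A.count y ≤ 1 ∧ C.count y ≤ 1 := by
    obtain ⟨A, B, C, h1, hA, hB, hC⟩ := h.exists_split hx
    have hc := h1.count_eq y hy
    simp only [List.count_append, List.count_cons_of_ne hxy] at hc
    by_cases hAy : 2 ≤ A.count y
    · exact ⟨C, A, B, by simpa using h1.append_swap, hC, hA, hB, by omega, by omega⟩
    · by_cases hCy : 2 ≤ C.count y
      · refine ⟨B, C, A, ?_, hB, hC, hA, by omega, by omega⟩
        have h2 : RepresentsOn H S ((x :: A) ++ (x :: B ++ x :: C)) := by simpa using h1
        simpa using h2.append_swap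
      · exact ⟨A, B, C, h1, hA, hB, hC, by omega, by omega⟩
  have hc := h1.count_eq y hy
  simp only [List.count_append, List.count_cons_of_ne hxy] at hc
  obtain ⟨B₁, R, rfl, hB₁⟩ := List.eq_append_cons_of_mem
    (List.count_pos_iff.1 (show 0 < B.count y by omega))
  have hB0 := List.count_eq_zero.2 hB₁
  rw [List.count_append, List.count_cons_self] at hc
  simp only [List.mem_append, List.mem_cons, not_or] at hB
  by_cases hAy0 : A.count y = 1
  · exact ⟨A, B₁, R, C, by simpa using h1, hA, hB.1, hB.2.2, hC, by omega, by omega⟩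
  · obtain ⟨B₂, D, rfl, hB₂⟩ := List.eq_append_cons_of_mem
      (List.count_pos_iff.1 (show 0 < R.count y by omega))
    have hB20 := List.count_eq_zero.2 hB₂
    rw [List.count_append, List.count_cons_self] at hc
    simp only [List.mem_append, List.mem_cons, not_or] at hB
    refine ⟨A, B₁ ++ y :: B₂, D, C, by simpa using h1, hA, ?_, hB.2.2.2.2, hC, ?_, ?_⟩
    · simp only [List.mem_append, List.mem_cons, not_or]
      exact ⟨hB.1, hB.2.1, hB.2.2.1⟩
    · rw [List.count_append, List.count_cons_self]; omega
    · omega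

end RepresentsOn

theorem alternate_iff_isChain (w : List W) (a b : W) : Alternate w a b ↔
    (w.filter (fun z => decide (z = a) || decide (z = b))).IsChain (· ≠ ·) := by
  simp only [← Bool.decide_or]
  rfl

theorem filter_pair_eq_replicate {A : List W} {a b : W} (ha : a ∉ A) :
    A.filter (fun z => decide (z = a) || decide (z = b)) = List.replicate (A.count b) b := by
  rw [← List.filter_eq]
  refine List.filter_congr fun z hz => ?_
  have : z ≠ a := fun h => ha (h ▸ hz)
  simp [this]

theorem filter_pair_eq_nil {A : List W} {a b : W} (ha : a ∉ A) (hb : b ∉ A) :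
    A.filter (fun z => decide (z = a) || decide (z = b)) = [] := by
  rw [filter_pair_eq_replicate ha, List.count_eq_zero.2 hb, List.replicate_zero]

theorem filter_ne_eq_self {A : List W} {u : W} (hu : u ∉ A) :
    A.filter (fun z => !decide (z = u)) = A := by
  rw [List.filter_eq_self]
  intro z hz
  simpa using fun h : z = u => hu (h ▸ hz)

namespace RepresentsOn

variable {H : SimpleGraph W} {S : Set W}

theorem insert_leaf {A B C : List W} {x u : W}
    (h : RepresentsOn H S (x :: A ++ x :: B ++ x :: C)) (hA : x ∉ A) (hB : x ∉ B) (hC : x ∉ C)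
    (hu : u ∉ S) (hadj : ∀ z ∈ S, H.Adj u z ↔ z = x) :
    RepresentsOn H (insert u S) (u :: x :: u :: A ++ x :: u :: B ++ x :: C) := by
  have hu1 := h.notMem u hu
  simp only [List.cons_append, List.append_assoc, List.mem_append, List.mem_cons, not_or] at hu1
  obtain ⟨hux, huA, -, huB, -, huC⟩ := hu1
  refine h.insert_letter ?_ ?_ ?_
  · simp [filter_ne_eq_self, huA, huB, huC, Ne.symm hux]
  · simp [List.count_eq_zero.2, huA, huB, huC, Ne.symm hux]
  · intro z hz hzu
    rw [hadj z hz]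
    by_cases hzx : z = x
    · subst hzx
      simp [alternate_iff_isChain, filter_pair_eq_nil, huA, huB, huC, hA, hB, hC, hux, hzu]
    · simp only [hzx, iff_false]
      exact not_alternate_of_repeat (P := []) (M := [x]) (Q := A ++ x :: u :: B ++ x :: C)
        (by simp) (by simpa using ⟨Ne.symm hux, Ne.symm hzx⟩)

theorem exists_insert_leaf {w : List W} (h : RepresentsOn H S w) {x u : W} (hx : x ∈ S)
    (hu : u ∉ S) (hadj : ∀ z ∈ S, H.Adj u z ↔ z = x) :
    ∃ w', RepresentsOn H (insert u S) w' := by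
  obtain ⟨A, B, C, h1, hA, hB, hC⟩ := h.exists_split hx
  exact ⟨_, h1.insert_leaf hA hB hC hu hadj⟩

theorem exists_insert_triangle {w : List W} (h : RepresentsOn H S w) {x u v : W} (hx : x ∈ S)
    (hu : u ∉ S) (hv : v ∉ S) (huv : u ≠ v) (hadju : ∀ z ∈ S, H.Adj u z ↔ z = x)
    (hadjv : ∀ z ∈ S, H.Adj v z ↔ z = x) (hadj : H.Adj v u) :
    ∃ w', RepresentsOn H (insert v (insert u S)) w' := by
  obtain ⟨A, B, C, h1, hA, hB, hC⟩ := h.exists_split hx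
  have hu1 := h1.notMem u hu
  simp only [List.cons_append, List.append_assoc, List.mem_append, List.mem_cons, not_or] at hu1
  obtain ⟨hux, huA, -, huB, -, huC⟩ := hu1
  have hv1 := h1.notMem v hv
  simp only [List.cons_append, List.append_assoc, List.mem_append, List.mem_cons, not_or] at hv1
  obtain ⟨hvx, hvA, -, hvB, -, hvC⟩ := hv1
  have h2 := h1.insert_leaf hA hB hC hu hadju
  refine ⟨v :: u :: x :: v :: u :: A ++ x :: v :: u :: B ++ x :: C, h2.insert_letter ?_ ?_ ?_⟩
  · simp [filter_ne_eq_self, hvA, hvB, hvC, Ne.symm hvx, huv]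
  · simp [List.count_eq_zero.2, hvA, hvB, hvC, Ne.symm hvx, huv]
  · rintro z (rfl | hz) hzv
    · simp [alternate_iff_isChain, filter_pair_eq_nil, huA, huB, huC, hvA, hvB, hvC,
        Ne.symm hux, Ne.symm hvx, huv, huv.symm, hadj]
    · rw [hadjv z hz]
      by_cases hzx : z = x
      · subst hzx
        simp [alternate_iff_isChain, filter_pair_eq_nil, hvA, hvB, hvC, hA, hB, hC, hvx,
          hux, huv, hzv]
      · simp only [hzx, iff_false]
        have hzu : u ≠ z := fun h => hu (h ▸ hz)
        exact not_alternate_of_repeat (P := []) (M := [u, x])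
          (Q := u :: A ++ x :: v :: u :: B ++ x :: C)
          (by simp) (by simpa using ⟨⟨huv, hzu⟩, Ne.symm hvx, Ne.symm hzx⟩)

theorem exists_insert_pair {w : List W} (h : RepresentsOn H S w) {x y u v : W} (hx : x ∈ S)
    (hy : y ∈ S) (hxy : x ≠ y)
    (hu : u ∉ S) (hv : v ∉ S) (huv : u ≠ v) (hadju : ∀ z ∈ S, H.Adj u z ↔ z = x)
    (hadjv : ∀ z ∈ S, H.Adj v z ↔ z = y) (hadj : H.Adj v u) :
    ∃ w', RepresentsOn H (insert v (insert u S)) w' := by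
  obtain ⟨A, B, D, C, h1, hA, hB, hD, hC, hAB, hDC⟩ := h.exists_split_pair hx hy hxy
  have hu1 := h1.notMem u hu
  simp only [List.cons_append, List.append_assoc, List.mem_append, List.mem_cons, not_or] at hu1
  obtain ⟨hux, huA, -, huB, huy, huD, -, huC⟩ := hu1
  have hv1 := h1.notMem v hv
  simp only [List.cons_append, List.append_assoc, List.mem_append, List.mem_cons, not_or] at hv1
  obtain ⟨hvx, hvA, -, hvB, hvy, hvD, -, hvC⟩ := hv1
  have h2 : RepresentsOn H (insert u S)
      (u :: x :: u :: A ++ x :: B ++ y :: u :: D ++ x :: C) := by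
    refine h1.insert_letter ?_ ?_ ?_
    · simp [filter_ne_eq_self, huA, huB, huC, huD, Ne.symm hux, Ne.symm huy]
    · simp [List.count_eq_zero.2, huA, huB, huC, huD, Ne.symm hux, Ne.symm huy]
    · intro z hz hzu
      rw [hadju z hz]
      by_cases hzx : z = x
      · subst hzx
        simp [alternate_iff_isChain, filter_pair_eq_nil, huA, huB, huC, huD, hA, hB, hC,
          hD, hux, hzu, Ne.symm huy, hxy.symm]
      · simp only [hzx, iff_false]
        exact not_alternate_of_repeat (P := []) (M := [x])
          (Q := A ++ x :: B ++ y :: u :: D ++ x :: C)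
          (by simp) (by simpa using ⟨Ne.symm hux, Ne.symm hzx⟩)
  refine ⟨u :: x :: v :: u :: A ++ x :: B ++ v :: y :: u :: v :: D ++ x :: C,
    h2.insert_letter ?_ ?_ ?_⟩
  · simp [filter_ne_eq_self, hvA, hvB, hvC, hvD, Ne.symm hvx, Ne.symm hvy, huv]
  · simp [List.count_eq_zero.2, hvA, hvB, hvC, hvD, Ne.symm hvx, Ne.symm hvy,
      huv]
  · rintro z (rfl | hz) hzv
    · simp [alternate_iff_isChain, filter_pair_eq_nil, huA, huB, huC, huD, hvA, hvB, hvC,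
        hvD, Ne.symm hux, Ne.symm hvx, Ne.symm huy, Ne.symm hvy, huv, huv.symm, hadj]
    · rw [hadjv z hz]
      have hzu : u ≠ z := fun h => hu (h ▸ hz)
      by_cases hzy : z = y
      · subst hzy
        obtain ⟨h3, h4⟩ | ⟨h3, h4⟩ : (A.count z = 0 ∧ B.count z = 1) ∨
            (A.count z = 1 ∧ B.count z = 0) := by omega
        all_goals
          obtain ⟨h5, h6⟩ | ⟨h5, h6⟩ : (D.count z = 0 ∧ C.count z = 1) ∨
            (D.count z = 1 ∧ C.count z = 0) := by omega
          all_goals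
            simp [alternate_iff_isChain, filter_pair_eq_replicate, hvA, hvB, hvC, hvD,
              h3, h4, h5, h6, Ne.symm hvx, huv, hzu, hxy, hzv, hzv.symm]
      · simp only [hzy, iff_false]
        exact not_alternate_of_repeat (P := u :: x :: v :: u :: A ++ x :: B) (M := [y, u])
          (Q := D ++ x :: C)
          (by simp) (by simpa using ⟨⟨Ne.symm hvy, Ne.symm hzy⟩, huv, hzu⟩)

end RepresentsOn

theorem RepresentsOn.kRepresentable {H : SimpleGraph W} {S : Set W} {w : List W}
    (h : RepresentsOn H S w) (hS : ∀ z, z ∈ S) : KRepresentable H 3 :=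
  ⟨w, fun z => h.count_eq z (hS z),
    fun z => List.count_pos_iff.1 (by rw [h.count_eq z (hS z)]; norm_num),
    fun a b hab => h.alternate_iff a (hS a) b (hS b) hab⟩

section Map

variable {V : Type*} [DecidableEq V] {f : V → W}

theorem count_map_eq (hf : Function.Injective f) (w : List V) (v : V) :
    (w.map f).count (f v) = w.count v :=
  List.count_map_of_injective w f hf v

theorem alternate_map (hf : Function.Injective f) (w : List V) (a b : V) :
    Alternate (w.map f) (f a) (f b) ↔ Alternate w a b := by
  rw [alternate_iff_isChain, alternate_iff_isChain, List.filter_map]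
  simp [List.isChain_map, Function.comp_def, hf.eq_iff]

/-- Representability passes to an induced subgraph. -/
theorem kRepresentable_of_injective (hf : Function.Injective f) {G : SimpleGraph V}
    {H : SimpleGraph W} (hadj : ∀ a b : V, H.Adj (f a) (f b) ↔ G.Adj a b) {k : ℕ}
    (h : KRepresentable H k) : KRepresentable G k := by
  classical
  obtain ⟨w, hk, hmem, halt⟩ := h
  obtain ⟨w', hw'⟩ : ∃ w' : List V, w'.map f = w.filter (fun z => decide (z ∈ Set.range f)) := by
    rw [← Set.mem_range, Set.range_list_map]
    intro z hz
    simpa using (List.mem_filter.1 hz).2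
  refine ⟨w', fun v => ?_, fun v => ?_, fun a b hab => ?_⟩
  · rw [← count_map_eq hf, hw', List.count_filter (by simp)]
    exact hk _
  · rw [← List.mem_map_of_injective hf, hw', List.mem_filter]
    exact ⟨hmem _, by simp⟩
  · rw [← hadj, ← halt _ _ (hf.ne hab), ← alternate_map hf, hw']
    unfold Alternate
    rw [List.filter_filter]
    have : (fun z : W => decide (z = f a ∨ z = f b) && decide (z ∈ Set.range f)) =
        (fun z => decide (z = f a ∨ z = f b)) := by
      funext z
      rw [← Bool.decide_and, decide_eq_decide]
      refine and_iff_left_of_imp ?_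
      rintro (rfl | rfl) <;> exact Set.mem_range_self _
    rw [this]

end Map

/-- The old vertices together with the first `n` path vertices. -/
def initialPart (V : Type*) (m n : ℕ) : Set (V ⊕ Fin m) :=
  {z | ∀ i : Fin m, z = Sum.inr i → (i : ℕ) < n}

theorem inl_mem_initialPart {V : Type*} {m : ℕ} (n : ℕ) (v : V) :
    (Sum.inl v : V ⊕ Fin m) ∈ initialPart V m n := by
  simp [initialPart]

theorem inr_mem_initialPart {V : Type*} {m n : ℕ} {i : Fin m} :
    (Sum.inr i : V ⊕ Fin m) ∈ initialPart V m n ↔ (i : ℕ) < n := by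
  simp [initialPart]

theorem insert_initialPart {V : Type*} {m n : ℕ} (hn : n < m) :
    insert (Sum.inr ⟨n, hn⟩) (initialPart V m n) = initialPart V m (n + 1) := by
  ext z
  rcases z with v | i
  · simp [inl_mem_initialPart]
  · simp only [Set.mem_insert_iff, inr_mem_initialPart, Sum.inr.injEq, Fin.ext_iff]
    omega

/-- The vertex of the path that precedes the path vertex with index `n`. -/
def pathPred {V : Type*} {m : ℕ} (x : V) : (n : ℕ) → n < m → V ⊕ Fin m
  | 0, _ => Sum.inl x
  | n + 1, h => Sum.inr ⟨n, Nat.lt_of_succ_lt h⟩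

theorem pathPred_mem {V : Type*} {m : ℕ} (x : V) (n : ℕ) (h : n < m) :
    pathPred x n h ∈ initialPart V m n := by
  cases n with
  | zero => exact inl_mem_initialPart _ _
  | succ n => exact inr_mem_initialPart.2 (Nat.lt_succ_self n)

theorem kRepresentable_add_path {V : Type*} [DecidableEq V] {G : SimpleGraph V}
    (hG : KRepresentable G 3) (x y : V) (ℓ : ℕ) (hℓ : 3 ≤ ℓ)
    (H : SimpleGraph (V ⊕ Fin (ℓ - 1)))
    (hvv : ∀ a b : V, H.Adj (Sum.inl a) (Sum.inl b) ↔ G.Adj a b)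
    (hvp : ∀ (a : V) (i : Fin (ℓ - 1)), H.Adj (Sum.inl a) (Sum.inr i) ↔
      ((a = x ∧ (i : ℕ) = 0) ∨ (a = y ∧ (i : ℕ) = ℓ - 2)))
    (hpp : ∀ i j : Fin (ℓ - 1), H.Adj (Sum.inr i) (Sum.inr j) ↔
      ((i : ℕ) + 1 = (j : ℕ) ∨ (j : ℕ) + 1 = (i : ℕ))) :
    KRepresentable H 3 := by
  have hpred : ∀ (n : ℕ) (hn : n < ℓ - 1), n ≠ ℓ - 2 → ∀ z ∈ initialPart V (ℓ - 1) n,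
      (H.Adj (Sum.inr ⟨n, hn⟩) z ↔ z = pathPred x n hn) := by
    rintro n hn hne (a | i) hz
    · rw [H.adj_comm, hvp]
      cases n with
      | zero => simp [pathPred, hne]
      | succ n => simp [pathPred, hne]
    · rw [inr_mem_initialPart] at hz
      rw [hpp]
      cases n with
      | zero => omega
      | succ n =>
        simp only [pathPred, Sum.inr.injEq, Fin.ext_iff]
        omega
  have hrep : ∀ n ≤ ℓ - 3, ∃ w, RepresentsOn H (initialPart V (ℓ - 1) n) w := by
    intro n
    induction n with
    | zero =>
      intro _
      obtain ⟨w, hk, -, halt⟩ := hG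
      refine ⟨w.map Sum.inl, ?_, ?_, ?_⟩
      · rintro (v | i) hv
        · rw [count_map_eq Sum.inl_injective, hk]
        · exact absurd (inr_mem_initialPart.1 hv) (Nat.not_lt_zero _)
      · rintro (v | i) hv
        · exact absurd (inl_mem_initialPart _ v) hv
        · simp
      · rintro (a | i) ha (b | j) hb hab
        · rw [alternate_map Sum.inl_injective, hvv]
          exact halt a b fun h => hab (h ▸ rfl)
        · exact absurd (inr_mem_initialPart.1 hb) (Nat.not_lt_zero _)
        all_goals exact absurd (inr_mem_initialPart.1 ha) (Nat.not_lt_zero _)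
    | succ n ih =>
      intro hn
      obtain ⟨w, hw⟩ := ih (by omega)
      have hlt : n < ℓ - 1 := by omega
      rw [← insert_initialPart hlt]
      exact hw.exists_insert_leaf (pathPred_mem x n hlt)
        (fun h => lt_irrefl _ (inr_mem_initialPart.1 h)) (hpred n hlt (by omega))
  obtain ⟨w, hw⟩ := hrep (ℓ - 3) le_rfl
  have hlt : ℓ - 3 < ℓ - 1 := by omega
  have hlt' : ℓ - 3 + 1 < ℓ - 1 := by omega
  have hadju := hpred (ℓ - 3) hlt (by omega)
  have hadjv : ∀ z ∈ initialPart V (ℓ - 1) (ℓ - 3),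
      (H.Adj (Sum.inr ⟨ℓ - 3 + 1, hlt'⟩) z ↔ z = Sum.inl y) := by
    rintro (a | i) hz
    · rw [H.adj_comm, hvp]
      simp only [Sum.inl.injEq]
      have h1 : ℓ - 3 + 1 = ℓ - 2 := by omega
      have h2 : ℓ - 2 ≠ 0 := by omega
      simp [h1, h2]
    · rw [inr_mem_initialPart] at hz
      rw [hpp]
      simp only [reduceCtorEq, iff_false]
      omega
  have hadj : H.Adj (Sum.inr ⟨ℓ - 3 + 1, hlt'⟩) (Sum.inr ⟨ℓ - 3, hlt⟩) := by
    rw [hpp]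
    exact Or.inr rfl
  have hu : (Sum.inr ⟨ℓ - 3, hlt⟩ : V ⊕ Fin (ℓ - 1)) ∉ initialPart V (ℓ - 1) (ℓ - 3) :=
    fun h => lt_irrefl _ (inr_mem_initialPart.1 h)
  have hv : (Sum.inr ⟨ℓ - 3 + 1, hlt'⟩ : V ⊕ Fin (ℓ - 1)) ∉ initialPart V (ℓ - 1) (ℓ - 3) :=
    fun h => absurd (inr_mem_initialPart.1 h) (by simp)
  have huv : (Sum.inr ⟨ℓ - 3, hlt⟩ : V ⊕ Fin (ℓ - 1)) ≠ Sum.inr ⟨ℓ - 3 + 1, hlt'⟩ := by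
    simp
  have hx := pathPred_mem x (ℓ - 3) hlt
  have hy := inl_mem_initialPart (m := ℓ - 1) (ℓ - 3) y
  obtain ⟨w', hw'⟩ : ∃ w', RepresentsOn H (initialPart V (ℓ - 1) (ℓ - 3 + 1 + 1)) w' := by
    rw [← insert_initialPart hlt', ← insert_initialPart hlt]
    by_cases hxy : pathPred x (ℓ - 3) hlt = Sum.inl y
    · rw [hxy] at hadju
      exact hw.exists_insert_triangle hy hu hv huv hadju hadjv hadj
    · exact hw.exists_insert_pair hx hy hxy hu hv huv hadju hadjv hadj
  have hall : ∀ z, z ∈ initialPart V (ℓ - 1) (ℓ - 3 + 1 + 1) := by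
    rintro (v | i)
    · exact inl_mem_initialPart _ _
    · exact inr_mem_initialPart.2 (by omega)
  exact hw'.kRepresentable hall

end WordGraph

/-- Let `G` be word-representable with representation number 3, and let `H` (on vertex set
`V ⊕ Fin (ℓ - 1)`) be obtained from `G` by adding a path of length `ℓ ≥ 3` connecting `x`
and `y`: the `ℓ - 1` new vertices form a path `x - v₀ - v₁ - ⋯ - v_{ℓ-2} - y`.
Then `H` is word-representable with representation number 3. -/
theorem reprNum_add_path {V : Type*} [DecidableEq V]
    (G : SimpleGraph V) (hG : WordRepresentable G) (hR : reprNum G = 3)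
    (x y : V) (ℓ : ℕ) (hℓ : 3 ≤ ℓ)
    (H : SimpleGraph (V ⊕ Fin (ℓ - 1)))
    (hvv : ∀ a b : V, H.Adj (Sum.inl a) (Sum.inl b) ↔ G.Adj a b)
    (hvp : ∀ (a : V) (i : Fin (ℓ - 1)), H.Adj (Sum.inl a) (Sum.inr i) ↔
      ((a = x ∧ (i : ℕ) = 0) ∨ (a = y ∧ (i : ℕ) = ℓ - 2)))
    (hpp : ∀ i j : Fin (ℓ - 1), H.Adj (Sum.inr i) (Sum.inr j) ↔
      ((i : ℕ) + 1 = (j : ℕ) ∨ (j : ℕ) + 1 = (i : ℕ))) :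
    WordRepresentable H ∧ reprNum H = 3 := by
  have hmem : 3 ∈ {k | KRepresentable G k} := by
    rw [← hR]
    exact Nat.sInf_mem (Nat.nonempty_of_sInf_eq_succ hR)
  have hH := WordGraph.kRepresentable_add_path hmem x y ℓ hℓ H hvv hvp hpp
  refine ⟨hH.imp fun _ h => h.2, le_antisymm (Nat.sInf_le hH) ?_⟩
  refine le_csInf ⟨3, hH⟩ fun k hk => ?_
  rw [← hR]
  exact Nat.sInf_le (WordGraph.kRepresentable_of_injective Sum.inl_injective hvv hk)
end

section
/- The Petersen graph is 3-word-representable but not 2-word-representable; hence its representation number equals 3. -/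
/-- The Petersen graph: vertices are the 2-element subsets of a 5-element set, two
vertices being adjacent iff the corresponding subsets are disjoint. -/
def petersen : SimpleGraph {s : Finset (Fin 5) // s.card = 2} :=
  SimpleGraph.fromRel (fun a b => Disjoint a.1 b.1)

/-- The intervals `(a u, b u)` and `(a v, b v)` overlap without being nested. -/
def Interleave {V : Type*} (a b : V → ℕ) (u v : V) : Prop :=
  a u < a v ∧ a v < b u ∧ b u < b v ∨ a v < a u ∧ a u < b v ∧ b v < b u

/-- The interval `(a v, b v)` is contained in `(a u, b u)`. -/
def Encloses {V : Type*} (a b : V → ℕ) (u v : V) : Prop :=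
  a u < a v ∧ b v < b u

section Word

variable {V : Type*} [DecidableEq V] {w : List V}

lemma exists_positions_of_count_eq_two {v : V} (h : w.count v = 2) :
    ∃ i j : ℕ, i < j ∧ ∀ k : ℕ, w[k]? = some v ↔ k = i ∨ k = j := by
  have hl : (w.idxsOf v).length = 2 := by simpa using h
  obtain ⟨i, j, hij⟩ := List.length_eq_two.mp hl
  have hp : (w.idxsOf v).Pairwise (· < ·) := List.pairwise_idxsOf
  refine ⟨i, j, by simpa [hij] using hp, fun k => ?_⟩
  have hk : k ∈ w.idxsOf v ↔ ∃ h : k < w.length, w[k] = v := by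
    simp
  rw [hij] at hk
  rw [List.getElem?_eq_some_iff, ← hk]
  simp

lemma filter_pair_perm {k : ℕ} (h : KUniform k w) {x y : V} (hxy : x ≠ y) :
    (w.filter (fun z => decide (z = x ∨ z = y))).Perm
      (List.replicate k x ++ List.replicate k y) := by
  rw [List.perm_iff_count]
  intro z
  have hz := h z
  by_cases hp : z = x ∨ z = y
  · rw [List.count_filter (by simpa using hp), hz]
    rcases hp with rfl | rfl
    · simp [List.count_replicate, hxy.symm]
    · simp [List.count_replicate, hxy]
  · have hx : x ≠ z := fun e => hp (Or.inl e.symm)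
    have hy : y ≠ z := fun e => hp (Or.inr e.symm)
    rw [List.count_eq_zero_of_not_mem (by simp [hp])]
    simp [List.count_replicate, hx, hy]

lemma alternate_of_kUniform_one (h : KUniform 1 w) {x y : V} (hxy : x ≠ y) :
    Alternate w x y := by
  have hp := filter_pair_perm h hxy
  have hn := hp.nodup_iff.mpr (by simpa using hxy)
  exact List.Pairwise.isChain hn

lemma alternate_iff_interleave (h : KUniform 2 w) {a b : V → ℕ} (hab : ∀ v, a v < b v)
    (hpos : ∀ v k, w[k]? = some v ↔ k = a v ∨ k = b v) {x y : V} (hxy : x ≠ y) :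
    Alternate w x y ↔ Interleave a b x y := by
  have hp := filter_pair_perm h hxy
  have hs : (w.filter (fun z => decide (z = x ∨ z = y))).Sublist w := List.filter_sublist
  unfold Alternate Interleave
  generalize w.filter (fun z => decide (z = x ∨ z = y)) = f at hp hs
  change f.IsChain (· ≠ ·) ↔ _
  obtain ⟨p, q, r, s, rfl⟩ : ∃ p q r s, f = [p, q, r, s] := by
    have hl : f.length = 4 := by simpa using hp.length_eq
    match f, hl with
    | [p, q, r, s], _ => exact ⟨p, q, r, s, rfl⟩
  obtain ⟨g, hg⟩ := List.sublist_iff_exists_orderEmbedding_getElem?_eq.mp hs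
  have h01 : g 0 < g 1 := g.strictMono (by norm_num)
  have h12 : g 1 < g 2 := g.strictMono (by norm_num)
  have h23 : g 2 < g 3 := g.strictMono (by norm_num)
  have hg0 := (hpos p (g 0)).mp (by simp [← hg])
  have hg1 := (hpos q (g 1)).mp (by simp [← hg])
  have hg2 := (hpos r (g 2)).mp (by simp [← hg])
  have hg3 := (hpos s (g 3)).mp (by simp [← hg])
  have hx := hab x
  have hy := hab y
  have hcx := hp.count_eq x
  have hmem : ∀ z ∈ [p, q, r, s], z = x ∨ z = y := fun z hz => by
    simpa using hp.mem_iff.mp hz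
  simp only [List.mem_cons, List.not_mem_nil, or_false, forall_eq_or_imp, forall_eq] at hmem
  obtain ⟨rfl | rfl, rfl | rfl, rfl | rfl, rfl | rfl⟩ := hmem <;>
    simp [hxy, hxy.symm] at hcx ⊢ <;> omega

end Word

section Intervals

variable {V : Type*} {a b : V → ℕ}

lemma encloses_iff_of_interleave {q u v : V} (huv : Interleave a b u v)
    (hu : ¬ Interleave a b q u) (hv : ¬ Interleave a b q v)
    (hqu : a q ≠ a u ∧ a q ≠ b u ∧ b q ≠ a u ∧ b q ≠ b u)
    (hqv : a q ≠ a v ∧ a q ≠ b v ∧ b q ≠ a v ∧ b q ≠ b v)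
    (hab : ∀ v, a v < b v) :
    Encloses a b q u ↔ Encloses a b q v := by
  have := hab q
  have := hab u
  have := hab v
  unfold Interleave at *
  unfold Encloses
  omega

/-- Among three pairwise non-crossing chords that all cross a fourth one, some chord separates
the other two. -/
lemma exists_separating {x p q r : V} (hab : ∀ v, a v < b v)
    (hxp : Interleave a b x p) (hxq : Interleave a b x q) (hxr : Interleave a b x r)
    (hpq : ¬ Interleave a b p q) (hpr : ¬ Interleave a b p r) (hqr : ¬ Interleave a b q r)
    (dpq : a p ≠ a q ∧ a p ≠ b q ∧ b p ≠ a q ∧ b p ≠ b q)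
    (dpr : a p ≠ a r ∧ a p ≠ b r ∧ b p ≠ a r ∧ b p ≠ b r)
    (dqr : a q ≠ a r ∧ a q ≠ b r ∧ b q ≠ a r ∧ b q ≠ b r) :
    ¬ ((Encloses a b p q ↔ Encloses a b p r) ∧ (Encloses a b q p ↔ Encloses a b q r) ∧
      (Encloses a b r p ↔ Encloses a b r q)) := by
  have := hab p
  have := hab q
  have := hab r
  unfold Interleave at *
  unfold Encloses
  omega

end Intervals

instance : DecidableRel petersen.Adj :=
  fun u v => inferInstanceAs (Decidable (u ≠ v ∧ (Disjoint u.1 v.1 ∨ Disjoint v.1 u.1)))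

/-- The vertex `{i, j}` of the Petersen graph. -/
def vert (i j : Fin 5) (h : i ≠ j := by decide) : {s : Finset (Fin 5) // s.card = 2} :=
  ⟨{i, j}, Finset.card_pair h⟩

/-- A 3-uniform word representing the Petersen graph. -/
def petersenWord : List {s : Finset (Fin 5) // s.card = 2} :=
  [vert 0 1, vert 0 4, vert 1 3, vert 1 4, vert 2 3, vert 0 3, vert 2 4, vert 0 2, vert 1 4, vert 1 2,
    vert 0 3, vert 0 4, vert 3 4, vert 1 2, vert 0 1, vert 2 3, vert 1 3, vert 0 4, vert 0 2, vert 1 4,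
    vert 2 4, vert 1 3, vert 3 4, vert 0 2, vert 0 1, vert 0 3, vert 1 2, vert 3 4, vert 2 4, vert 2 3]

instance {V : Type*} [DecidableEq V] (w : List V) (x y : V) : Decidable (Alternate w x y) :=
  inferInstanceAs (Decidable (List.IsChain _ _))

lemma kRepresentable_petersen_three : KRepresentable petersen 3 := by
  refine ⟨petersenWord, ?_, ?_, ?_⟩
  · unfold KUniform
    decide +kernel
  · decide +kernel
  · decide +kernel

lemma not_kRepresentable_zero {V : Type*} [DecidableEq V] [Nonempty V] (G : SimpleGraph V) :
    ¬ KRepresentable G 0 := by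
  rintro ⟨w, hw, hr⟩
  exact List.count_eq_zero.mp (hw (Classical.arbitrary V)) (hr.1 _)

lemma not_kRepresentable_petersen_one : ¬ KRepresentable petersen 1 := by
  rintro ⟨w, hw, hr⟩
  have hne : vert 0 1 ≠ vert 0 2 := by decide
  exact absurd ((hr.2 _ _ hne).mp (alternate_of_kUniform_one hw hne)) (by decide)

lemma not_kRepresentable_petersen_two : ¬ KRepresentable petersen 2 := by
  rintro ⟨w, hw, hr⟩
  choose a b hab hpos using fun v => exists_positions_of_count_eq_two (hw v)
  have adj {u v} (h : petersen.Adj u v) : Interleave a b u v :=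
    (alternate_iff_interleave hw hab hpos h.ne).mp ((hr.2 _ _ h.ne).mpr h)
  have nadj {u v} (h : u ≠ v ∧ ¬ petersen.Adj u v) : ¬ Interleave a b u v := fun hi =>
    h.2 ((hr.2 _ _ h.1).mp ((alternate_iff_interleave hw hab hpos h.1).mpr hi))
  have dist {u v} (h : u ≠ v) : a u ≠ a v ∧ a u ≠ b v ∧ b u ≠ a v ∧ b u ≠ b v := by
    have ha := (hpos u (a u)).mpr (Or.inl rfl)
    have hb := (hpos u (b u)).mpr (Or.inr rfl)
    have key : ∀ k, w[k]? = some u → k ≠ a v ∧ k ≠ b v := fun k hk => by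
      rw [← not_or, ← hpos v k, hk]
      simpa using h
    exact ⟨(key _ ha).1, (key _ ha).2, (key _ hb).1, (key _ hb).2⟩
  have step {q u v} (huv : petersen.Adj u v) (hu : q ≠ u ∧ ¬ petersen.Adj q u)
      (hv : q ≠ v ∧ ¬ petersen.Adj q v) : Encloses a b q u ↔ Encloses a b q v :=
    encloses_iff_of_interleave (adj huv) (nadj hu) (nadj hv) (dist hu.1) (dist hv.1) hab
  have path {q t u v s} (h : petersen.Adj t u ∧ petersen.Adj u v ∧ petersen.Adj v s ∧
      ∀ z ∈ [t, u, v, s], q ≠ z ∧ ¬ petersen.Adj q z) :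
      Encloses a b q t ↔ Encloses a b q s := by
    obtain ⟨h₁, h₂, h₃, hz⟩ := h
    have ht := hz t (by simp)
    have hu := hz u (by simp)
    have hv := hz v (by simp)
    have hs := hz s (by simp)
    exact (step h₁ ht hu).trans ((step h₂ hu hv).trans (step h₃ hv hs))
  refine exists_separating (x := vert 0 1) (p := vert 2 3) (q := vert 2 4) (r := vert 3 4) hab
    (adj (by decide)) (adj (by decide)) (adj (by decide))
    (nadj (by decide)) (nadj (by decide)) (nadj (by decide))
    (dist (by decide)) (dist (by decide)) (dist (by decide)) ⟨?_, ?_, ?_⟩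
  · exact path (u := vert 1 3) (v := vert 0 2) (by decide)
  · exact path (u := vert 1 4) (v := vert 0 2) (by decide)
  · exact path (u := vert 0 4) (v := vert 1 3) (by decide)

/-- The Petersen graph is 3-word-representable but not 2-word-representable; hence its
representation number equals 3. -/
theorem petersen_representation_number_eq_three :
    KRepresentable petersen 3 ∧ ¬ KRepresentable petersen 2 ∧ reprNum petersen = 3 := by
  refine ⟨kRepresentable_petersen_three, not_kRepresentable_petersen_two,
    IsLeast.csInf_eq ⟨kRepresentable_petersen_three, fun k hk => ?_⟩⟩
  by_contra! hlt
  interval_cases k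
  · exact haveI : Nonempty _ := ⟨vert 0 1⟩; not_kRepresentable_zero petersen hk
  · exact not_kRepresentable_petersen_one hk
  · exact not_kRepresentable_petersen_two hk
end

section
/- For every n ≥ 3, the cycle graph C_n is 2-word-representable. -/
/-- The cycle graph `C n` on the vertices `1,…,n` with edges `(i, i+1)` for
`1 ≤ i ≤ n-1` and `(n, 1)` (addition modulo `n` on `Fin n`). -/
def cycleGraph (n : ℕ) : SimpleGraph (Fin n) :=
  SimpleGraph.fromRel (fun i j => (j : ℕ) = ((i : ℕ) + 1) % n)

/-- The letter at position `k` of the word `0 (n-1) 1 0 2 1 ⋯ (n-1) (n-2)`. -/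
def cycleLetter (n : ℕ) (hn : 0 < n) (k : ℕ) : Fin n :=
  ⟨(if k = 1 then n - 1 else if k % 2 = 0 then k / 2 else k / 2 - 1) % n, Nat.mod_lt _ hn⟩

theorem cycleLetter_eq_iff {n : ℕ} (hn : 3 ≤ n) (hn0 : 0 < n) {k : ℕ} (hk : k < 2 * n)
    (v : Fin n) :
    cycleLetter n hn0 k = v ↔
      k = 2 * (v : ℕ) ∨ ((v : ℕ) + 1 < n ∧ k = 2 * (v : ℕ) + 3) ∨ ((v : ℕ) + 1 = n ∧ k = 1) := by
  have hv := v.isLt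
  rw [Fin.ext_iff, cycleLetter]
  dsimp only
  rw [Nat.mod_eq_of_lt (by split_ifs <;> omega)]
  split_ifs <;> omega

theorem List.filter_range_eq_of_pairwise_lt {N : ℕ} {p : ℕ → Bool} {l : List ℕ}
    (hl : l.Pairwise (· < ·)) (h : ∀ k, k ∈ l ↔ k < N ∧ p k = true) :
    (List.range N).filter p = l := by
  have hr : ((List.range N).filter p).Pairwise (· < ·) := List.pairwise_lt_range.filter p
  refine List.Perm.eq_of_pairwise (fun a b _ _ hab hba => absurd hab (lt_asymm hba)) hr hl ?_
  rw [List.perm_ext_iff_of_nodup (hr.imp ne_of_lt) (hl.imp ne_of_lt)]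
  intro k
  simp [h]

theorem cycleWord_kUniform {n : ℕ} (hn : 3 ≤ n) (hn0 : 0 < n) :
    KUniform 2 ((List.range (2 * n)).map (cycleLetter n hn0)) := by
  intro v
  have hv := v.isLt
  rw [List.count_eq_length_filter, List.filter_map, List.length_map]
  by_cases hvn : (v : ℕ) + 1 = n
  · rw [List.filter_range_eq_of_pairwise_lt (l := [1, 2 * (v : ℕ)])]
    · rfl
    · simp; omega
    · intro k
      by_cases hk : k < 2 * n
      · simp [cycleLetter_eq_iff hn hn0 hk, hk]; omega
      · simp [hk]; omega
  · rw [List.filter_range_eq_of_pairwise_lt (l := [2 * (v : ℕ), 2 * (v : ℕ) + 3])]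
    · rfl
    · simp
    · intro k
      by_cases hk : k < 2 * n
      · simp [cycleLetter_eq_iff hn hn0 hk, hk]; omega
      · simp [hk]; omega

/-- Alternation in the cycle word can be read off from the sorted list of positions of the two
letters. -/
theorem alternate_cycleWord_iff_of_positions {n : ℕ} (hn : 3 ≤ n) (hn0 : 0 < n) {x y : Fin n}
    {l : List ℕ} (hl : l.Pairwise (· < ·))
    (h : ∀ k, k ∈ l ↔ k < 2 * n ∧
      ((k = 2 * (x : ℕ) ∨ ((x : ℕ) + 1 < n ∧ k = 2 * (x : ℕ) + 3) ∨ ((x : ℕ) + 1 = n ∧ k = 1)) ∨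
       (k = 2 * (y : ℕ) ∨ ((y : ℕ) + 1 < n ∧ k = 2 * (y : ℕ) + 3) ∨
        ((y : ℕ) + 1 = n ∧ k = 1)))) :
    Alternate ((List.range (2 * n)).map (cycleLetter n hn0)) x y ↔
      (l.map (cycleLetter n hn0)).IsChain (· ≠ ·) := by
  unfold Alternate
  rw [List.filter_map, List.filter_range_eq_of_pairwise_lt hl ?_]
  · rfl
  intro k
  rw [h]
  refine and_congr_right fun hk => ?_
  simp [cycleLetter_eq_iff hn hn0 hk]

theorem cycleGraph_adj_iff_of_lt {n : ℕ} (hn : 3 ≤ n) {x y : Fin n} (h : x < y) :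
    (cycleGraph n).Adj x y ↔
      (y : ℕ) = (x : ℕ) + 1 ∨ ((x : ℕ) = 0 ∧ (y : ℕ) + 1 = n) := by
  have hy := y.isLt
  have h' : (x : ℕ) < y := h
  have hx : ((x : ℕ) + 1) % n = (x : ℕ) + 1 := Nat.mod_eq_of_lt (by omega)
  simp only [cycleGraph, SimpleGraph.fromRel_adj, hx, ne_eq, h.ne, not_false_eq_true, true_and]
  by_cases hyn : (y : ℕ) + 1 = n
  · rw [hyn, Nat.mod_self]; omega
  · rw [Nat.mod_eq_of_lt (by omega : (y : ℕ) + 1 < n)]; omega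

theorem alternate_cycleWord_iff {n : ℕ} (hn : 3 ≤ n) (hn0 : 0 < n) {x y : Fin n} (h : x < y) :
    Alternate ((List.range (2 * n)).map (cycleLetter n hn0)) x y ↔ (cycleGraph n).Adj x y := by
  rw [cycleGraph_adj_iff_of_lt hn h]
  have hy := y.isLt
  have h' : (x : ℕ) < y := h
  have letter_eq (v : Fin n) (k : ℕ) (hk : k < 2 * n) (hkv : k = 2 * (v : ℕ) ∨
      ((v : ℕ) + 1 < n ∧ k = 2 * (v : ℕ) + 3) ∨ ((v : ℕ) + 1 = n ∧ k = 1)) :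
      cycleLetter n hn0 k = v := (cycleLetter_eq_iff hn hn0 hk v).2 hkv
  have hx0 := letter_eq x (2 * x) (by omega) (by omega)
  have hx3 := letter_eq x (2 * x + 3) (by omega) (by omega)
  have hy0 := letter_eq y (2 * y) (by omega) (by omega)
  by_cases hyn : (y : ℕ) + 1 = n
  · have hy1 := letter_eq y 1 (by omega) (by omega)
    by_cases hx : (x : ℕ) = 0
    · rw [alternate_cycleWord_iff_of_positions hn hn0
        (l := [2 * (x : ℕ), 1, 2 * (x : ℕ) + 3, 2 * (y : ℕ)]) (by simp; omega)
        (by intro k; simp; omega)]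
      exact iff_of_true (by simp [hx0, hx3, hy0, hy1, h.ne, h.ne']) (Or.inr ⟨hx, hyn⟩)
    · by_cases hxy : (y : ℕ) = x + 1
      · rw [alternate_cycleWord_iff_of_positions hn hn0
          (l := [1, 2 * (x : ℕ), 2 * (y : ℕ), 2 * (x : ℕ) + 3]) (by simp; omega)
          (by intro k; simp; omega)]
        exact iff_of_true (by simp [hx0, hx3, hy0, hy1, h.ne, h.ne']) (Or.inl hxy)
      · rw [alternate_cycleWord_iff_of_positions hn hn0
          (l := [1, 2 * (x : ℕ), 2 * (x : ℕ) + 3, 2 * (y : ℕ)]) (by simp; omega)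
          (by intro k; simp; omega)]
        simp [hx0, hx3, hx, hxy]
  · have hy3 := letter_eq y (2 * y + 3) (by omega) (by omega)
    by_cases hxy : (y : ℕ) = x + 1
    · rw [alternate_cycleWord_iff_of_positions hn hn0
        (l := [2 * (x : ℕ), 2 * (y : ℕ), 2 * (x : ℕ) + 3, 2 * (y : ℕ) + 3]) (by simp; omega)
        (by intro k; simp; omega)]
      exact iff_of_true (by simp [hx0, hx3, hy0, hy3, h.ne, h.ne']) (Or.inl hxy)
    · rw [alternate_cycleWord_iff_of_positions hn hn0
        (l := [2 * (x : ℕ), 2 * (x : ℕ) + 3, 2 * (y : ℕ), 2 * (y : ℕ) + 3]) (by simp; omega)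
        (by intro k; simp; omega)]
      simp [hx0, hx3, hxy, hyn]

/-- For every `n ≥ 3`, the cycle graph `C n` is 2-word-representable. -/
theorem cycle_two_word_representable (n : ℕ) (hn : 3 ≤ n) :
    KRepresentable (cycleGraph n) 2 := by
  have hn0 : 0 < n := by omega
  refine ⟨(List.range (2 * n)).map (cycleLetter n hn0), cycleWord_kUniform hn hn0, ?_, ?_⟩
  · intro v
    rw [← List.count_pos_iff, cycleWord_kUniform hn hn0 v]
    norm_num
  · intro x y hxy
    rcases lt_or_gt_of_ne hxy with h | h
    · exact alternate_cycleWord_iff hn hn0 h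
    · rw [alternate_comm, alternate_cycleWord_iff hn hn0 h, SimpleGraph.adj_comm]
end

section
/- For every k ≥ 2, the graph G_k on 2k+1 vertices, obtained from the crown graph H_{k,k} by adding one new vertex adjacent to all 2k vertices of H_{k,k}, is word-representable with representation number exactly k. -/
/-- The crown graph `H_{k,k}` on vertices `{1,…,k} ∪ {1',…,k'}`, where `i` and `j'` are
adjacent iff `i ≠ j`. Vertices `Sum.inl i` are the unprimed ones, `Sum.inr j` the primed
ones. -/
def crown (k : ℕ) : SimpleGraph (Fin k ⊕ Fin k) :=
  SimpleGraph.fromRel (fun a b =>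
    match a, b with
    | Sum.inl i, Sum.inr j => i ≠ j
    | _, _ => False)

/-- The graph `G_k` on `2k + 1` vertices: the crown graph `H_{k,k}` together with one
additional all-adjacent vertex (the vertex `none`). -/
def Gk (k : ℕ) : SimpleGraph (Option (Fin k ⊕ Fin k)) :=
  SimpleGraph.fromRel (fun a b =>
    match a, b with
    | some u, some v => (crown k).Adj u v
    | none, some _ => True
    | _, _ => False)

namespace WordRep

variable {V : Type*} [DecidableEq V]

theorem alternate_comm {w : List V} {x y : V} : Alternate w x y ↔ Alternate w y x := by
  simp only [Alternate, or_comm]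

/-! ### Alternation through letter counts in factors -/

theorem count_le_of_isChain {x y : V} (hxy : x ≠ y) (l : List V)
    (hl : ∀ z ∈ l, z = x ∨ z = y) (hc : l.IsChain (· ≠ ·)) :
    (l.head? = some x → l.count y ≤ l.count x ∧ l.count x ≤ l.count y + 1) ∧
      (l.head? = some y → l.count x ≤ l.count y ∧ l.count y ≤ l.count x + 1) := by
  induction l with
  | nil => simp
  | cons a l ih =>
    have ih := ih (fun z hz => hl z (List.mem_cons_of_mem _ hz)) hc.tail
    have ha := hl a List.mem_cons_self
    cases l with
    | nil => grind
    | cons b l =>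
      have hb := hl b (by simp)
      have hab := (List.isChain_cons_cons.1 hc).1
      grind

theorem alternate_iff_infix {w : List V} {x y : V} (hxy : x ≠ y) :
    Alternate w x y ↔
      ∀ u, u <:+: w → u.count x ≤ u.count y + 1 ∧ u.count y ≤ u.count x + 1 := by
  constructor
  · intro h u hu
    have hc : (u.filter (fun z => decide (z = x ∨ z = y))).IsChain (· ≠ ·) :=
      List.IsChain.infix h (hu.filter _)
    have hl : ∀ z ∈ u.filter (fun z => decide (z = x ∨ z = y)), z = x ∨ z = y := by simp
    have key := count_le_of_isChain hxy _ hl hc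
    rw [List.count_filter (by simp), List.count_filter (by simp)] at key
    rcases hf : u.filter (fun z => decide (z = x ∨ z = y)) with _ | ⟨a, l⟩
    · have hx : u.count x = 0 := by
        rw [← List.count_filter (p := fun z => decide (z = x ∨ z = y)) (by simp), hf]; simp
      have hy : u.count y = 0 := by
        rw [← List.count_filter (p := fun z => decide (z = x ∨ z = y)) (by simp), hf]; simp
      omega
    · rw [hf] at key hl
      rcases hl a (by simp) with rfl | rfl
      · have := key.1 (by simp); omega
      · have := key.2 (by simp); omega
  · intro h
    change (w.filter (fun z => decide (z = x ∨ z = y))).IsChain (· ≠ ·)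
    induction w with
    | nil => simp
    | cons a w ih =>
      have ih := ih fun u hu => h u (hu.trans (List.suffix_cons a w).isInfix)
      by_cases ha : a = x ∨ a = y
      · rw [List.filter_cons_of_pos (by simpa using ha)]
        rcases hf : w.filter (fun z => decide (z = x ∨ z = y)) with _ | ⟨b, l⟩
        · simp
        · rw [hf] at ih
          refine List.isChain_cons_cons.2 ⟨?_, ih⟩
          rintro rfl
          obtain ⟨l₁, l₂, rfl, h₁, -, -⟩ := List.filter_eq_cons_iff.1 hf
          have hinf := h (a :: (l₁ ++ [a])) ⟨[], l₂, by simp⟩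
          have hx : l₁.count x = 0 := List.count_eq_zero.2 fun hm => by simpa using h₁ x hm
          have hy : l₁.count y = 0 := List.count_eq_zero.2 fun hm => by simpa using h₁ y hm
          rcases ha with rfl | rfl <;> simp [hx, hy, hxy, hxy.symm] at hinf
      · rw [List.filter_cons_of_neg (by simpa using ha)]
        exact ih

theorem Alternate.append_swap {p q : List V} {x y : V} (hxy : x ≠ y)
    (hcount : (p ++ q).count x = (p ++ q).count y) (h : Alternate (p ++ q) x y) :
    Alternate (q ++ p) x y := by
  rw [alternate_iff_infix hxy] at h ⊢
  intro u hu
  rcases List.infix_append_iff.1 hu with hu | hu | ⟨u₁, u₂, rfl, ⟨s, rfl⟩, ⟨t, rfl⟩⟩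
  · exact h u (hu.trans (List.suffix_append p q).isInfix)
  · exact h u (hu.trans (List.prefix_append p q).isInfix)
  · have := h (t ++ s) ⟨u₂, u₁, by simp⟩
    simp only [List.count_append] at this hcount ⊢
    omega

theorem kUniform_append_swap {p q : List V} {m : ℕ} (hu : KUniform m (p ++ q)) :
    KUniform m (q ++ p) := fun v => by
  rw [← hu v, List.count_append, List.count_append, add_comm]

theorem represents_append_swap {p q : List V} {G : SimpleGraph V} {m : ℕ}
    (hu : KUniform m (p ++ q)) (h : Represents (p ++ q) G) : Represents (q ++ p) G := by
  refine ⟨fun v => by simpa [or_comm] using h.1 v, fun x y hxy => ?_⟩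
  rw [← h.2 x y hxy]
  have hu' := kUniform_append_swap hu
  exact ⟨Alternate.append_swap hxy ((hu' x).trans (hu' y).symm),
    Alternate.append_swap hxy ((hu x).trans (hu y).symm)⟩

/-! ### Positions of occurrences -/

/-- The length of the shortest prefix of `w` containing more than `t` copies of `x`. -/
noncomputable def occ (w : List V) (t : ℕ) (x : V) : ℕ :=
  sInf {n | t < (w.take n).count x}

theorem count_take_mono (w : List V) (x : V) {n n' : ℕ} (h : n ≤ n') :
    (w.take n).count x ≤ (w.take n').count x :=
  (List.take_sublist_take_left h).count_le x

theorem occ_le_iff {w : List V} {t : ℕ} {x : V} (h : t < w.count x) {n : ℕ} :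
    occ w t x ≤ n ↔ t < (w.take n).count x := by
  have hmem : t < (w.take (occ w t x)).count x :=
    Nat.sInf_mem (s := {n | t < (w.take n).count x}) ⟨w.length, by simpa using h⟩
  exact ⟨fun hn => hmem.trans_le (count_take_mono w x hn), fun hn => Nat.sInf_le hn⟩

theorem occ_ne {w : List V} {t : ℕ} {x y : V} (hxy : x ≠ y) (hx : t < w.count x)
    (hy : t < w.count y) : occ w t x ≠ occ w t y := by
  intro h
  have hx₁ := (occ_le_iff hx).1 le_rfl
  have hy₁ := (occ_le_iff hy).1 le_rfl
  rw [← h] at hy₁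
  rcases hn : occ w t x with _ | n
  · simp [hn] at hx₁
  · have hx₂ := mt (occ_le_iff hx (n := n)).2 (by omega)
    have hy₂ := mt (occ_le_iff hy (n := n)).2 (by omega)
    rw [hn, List.take_add_one, List.count_append] at hx₁ hy₁
    rcases hw : w[n]? with _ | a
    · simp [hw] at hx₁; omega
    · simp only [hw, Option.toList_some, List.count_singleton] at hx₁ hy₁
      grind

theorem occ_lt_of_alternate {w : List V} {x y : V} (hxy : x ≠ y) (h : Alternate w x y)
    {s t : ℕ} (hsx : s < w.count x) (hsy : s < w.count y) (htx : t < w.count x)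
    (hty : t < w.count y) (hlt : occ w s x < occ w s y) : occ w t x < occ w t y := by
  rw [alternate_iff_infix hxy] at h
  by_contra hcon
  have hlt' : occ w t y < occ w t x := by
    have := occ_ne hxy htx hty
    omega
  have h₁ := (occ_le_iff hsx).1 le_rfl
  have h₂ := mt (occ_le_iff hsy).2 (not_le.2 hlt)
  have h₃ := (occ_le_iff hty).1 le_rfl
  have h₄ := mt (occ_le_iff htx).2 (not_le.2 hlt')
  have split : ∀ a b : ℕ, a ≤ b → ∃ u, u <:+: w ∧
      ∀ v, (w.take b).count v = (w.take a).count v + u.count v := by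
    intro a b hab
    refine ⟨(w.take b).drop a,
      (List.drop_suffix _ _).isInfix.trans (List.take_prefix _ _).isInfix, fun v => ?_⟩
    rw [← List.count_append, ← Nat.min_eq_left hab, ← List.take_take, Nat.min_eq_left hab,
      List.take_append_drop]
  rcases le_total (occ w s x) (occ w t y) with hle | hle <;>
  · obtain ⟨u, hu, hv⟩ := split _ _ hle
    have := h u hu
    have := hv x
    have := hv y
    omega

/-- If the letter `z` opens a uniform word and alternates with `x` and `y`, then `x` and `y`
alternate as soon as each occurrence of `x` precedes the matching occurrence of `y`. -/
theorem alternate_of_occ_lt {m : ℕ} {w : List V} {x y z : V} (hu : KUniform m (z :: w))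
    (hxy : x ≠ y) (hx : x ≠ z) (hy : y ≠ z) (hzx : Alternate (z :: w) z x)
    (hzy : Alternate (z :: w) z y)
    (h : ∀ t < m, occ (z :: w) t x < occ (z :: w) t y) : Alternate (z :: w) x y := by
  rw [alternate_iff_infix hx.symm] at hzx
  rw [alternate_iff_infix hy.symm] at hzy
  have hpre : ∀ n, ((z :: w).take n).count y ≤ ((z :: w).take n).count x := by
    intro n
    by_contra! hlt
    have hle : ((z :: w).take n).count y ≤ m :=
      (hu y) ▸ (List.take_sublist _ _).count_le y
    have h₁ := (occ_le_iff (w := z :: w) (x := y) (by rw [hu]; omega)).2 hlt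
    have h₂ := (occ_le_iff (w := z :: w) (x := x) (by rw [hu]; omega)).1
      ((h _ (hlt.trans_le hle)).le.trans h₁)
    omega
  have hpre' : ∀ n, ((z :: w).take n).count x ≤ ((z :: w).take n).count y + 1 := by
    intro n
    have h₁ := (hzy _ (List.take_prefix n _).isInfix).1
    rcases n with _ | n
    · simp
    · have h₂ := (hzx (w.take n)
        ((List.take_prefix n w).isInfix.trans (List.suffix_cons z w).isInfix)).2
      simp [hx.symm, hy.symm] at h₁ ⊢
      omega
  rw [alternate_iff_infix hxy]
  rintro u ⟨s, t, hst⟩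
  have e₁ : (z :: w).take s.length = s := by rw [← hst]; simp
  have e₂ : (z :: w).take (s ++ u).length = s ++ u := by
    rw [← hst]; exact List.take_left
  have a₁ := hpre s.length
  have a₂ := hpre (s ++ u).length
  have a₃ := hpre' s.length
  have a₄ := hpre' (s ++ u).length
  rw [e₁] at a₁ a₃
  rw [e₂, List.count_append, List.count_append] at a₂ a₄
  omega

/-! ### The lower bound -/

/-- The pigeonhole argument behind the dimension of the standard example. -/
theorem le_of_reversed {k m : ℕ} (a b : Fin k → ℕ → ℕ)
    (hlt : ∀ i j, i ≠ j → ∀ t < m, a i t < b j t)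
    (hrev : ∀ i, ∃ t < m, b i t < a i t) : k ≤ m := by
  choose f hf hfr using hrev
  have hinj : Function.Injective (fun i => (⟨f i, hf i⟩ : Fin m)) := by
    intro i j hij
    by_contra hne
    have hij : f i = f j := by simpa using hij
    have h₁ := hlt i j hne _ (hf i)
    have h₂ := hlt j i (Ne.symm hne) _ (hf i)
    have h₃ := hfr i
    have h₄ := hfr j
    rw [← hij] at h₄
    omega
  simpa using Fintype.card_le_of_injective _ hinj

theorem exists_third {k : ℕ} (hk : 3 ≤ k) (i j : Fin k) : ∃ l, l ≠ i ∧ l ≠ j := by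
  have : (({i, j} : Finset (Fin k))ᶜ).Nonempty := by
    rw [← Finset.card_pos, Finset.card_compl, Fintype.card_fin]
    have := Finset.card_le_two (a := i) (b := j)
    omega
  obtain ⟨l, hl⟩ := this
  exact ⟨l, by simpa using hl⟩

theorem Gk_adj_none {k : ℕ} (v : Fin k ⊕ Fin k) : (Gk k).Adj none (some v) := by
  simp [Gk]

theorem Gk_adj_inl_inr {k : ℕ} {i j : Fin k} :
    (Gk k).Adj (some (.inl i)) (some (.inr j)) ↔ i ≠ j := by
  simp [Gk, crown]

theorem Gk_not_adj_inl {k : ℕ} {i j : Fin k} :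
    ¬ (Gk k).Adj (some (.inl i)) (some (.inl j)) := by
  simp [Gk, crown]

theorem Gk_not_adj_inr {k : ℕ} {i j : Fin k} :
    ¬ (Gk k).Adj (some (.inr i)) (some (.inr j)) := by
  simp [Gk, crown]

theorem le_of_kRepresentable {k m : ℕ} (hk : 2 ≤ k) (h : KRepresentable (Gk k) m) : k ≤ m := by
  obtain ⟨w, hu, hw⟩ := h
  obtain ⟨p, q, rfl⟩ := List.append_of_mem (hw.1 none)
  have hw := represents_append_swap hu hw
  have hu := kUniform_append_swap hu
  rw [List.cons_append] at hu hw
  generalize q ++ p = w at hu hw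
  set T : ℕ → Fin k ⊕ Fin k → ℕ := fun t v => occ (none :: w) t (some v) with hT
  have hne : ∀ t < m, ∀ u v, u ≠ v → T t u ≠ T t v := fun t ht u v huv =>
    occ_ne (by simpa using huv) (by rwa [hu]) (by rwa [hu])
  have hnonadj : ∀ u v, u ≠ v → ¬ (Gk k).Adj (some u) (some v) → ¬ ∀ t < m, T t u < T t v := by
    intro u v huv hadj hlt
    have huv' : (some u : Option (Fin k ⊕ Fin k)) ≠ some v := by simpa using huv
    refine hadj ((hw.2 _ _ huv').1 (alternate_of_occ_lt hu huv' (by simp) (by simp) ?_ ?_ hlt))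
    · exact (hw.2 _ _ (by simp)).2 (Gk_adj_none u)
    · exact (hw.2 _ _ (by simp)).2 (Gk_adj_none v)
  have hrev : ∀ u v, u ≠ v → ¬ (Gk k).Adj (some u) (some v) → ∃ t < m, T t v < T t u := by
    intro u v huv hadj
    have := hnonadj u v huv hadj
    push Not at this
    obtain ⟨t, ht, hle⟩ := this
    exact ⟨t, ht, lt_of_le_of_ne hle (hne t ht _ _ huv.symm)⟩
  have hnadj : ∀ i : Fin k, ¬ (Gk k).Adj (some (.inl i)) (some (.inr i)) := by
    simp [Gk_adj_inl_inr]
  have hm : 2 ≤ m := by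
    obtain ⟨t, ht, h₁⟩ := hrev (.inl ⟨0, by omega⟩) (.inr ⟨0, by omega⟩) (by simp) (hnadj _)
    obtain ⟨s, hs, h₂⟩ := hrev (.inr ⟨0, by omega⟩) (.inl ⟨0, by omega⟩) (by simp)
      (fun h => hnadj _ h.symm)
    have : t ≠ s := by rintro rfl; omega
    omega
  rcases hk.eq_or_lt with rfl | hk
  · exact hm
  set U : Fin k → Fin k → Prop := fun i j => ∀ t < m, T t (.inl i) < T t (.inr j) with hU
  set D : Fin k → Fin k → Prop := fun i j => ∀ t < m, T t (.inr j) < T t (.inl i) with hD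
  have hUD : ∀ i j, i ≠ j → U i j ∨ D i j := by
    intro i j hij
    have halt := (hw.2 (some (.inl i)) (some (.inr j)) (by simp)).2 (Gk_adj_inl_inr.2 hij)
    have hm0 : 0 < m := by omega
    rcases lt_or_gt_of_ne (hne 0 hm0 (.inl i) (.inr j) (by simp)) with h | h
    · exact .inl fun t ht => occ_lt_of_alternate (by simp) halt (by rwa [hu]) (by rwa [hu])
        (by rwa [hu]) (by rwa [hu]) h
    · exact .inr fun t ht => occ_lt_of_alternate (by simp) (alternate_comm.1 halt)
        (by rwa [hu]) (by rwa [hu]) (by rwa [hu]) (by rwa [hu]) h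
  have hcol : ∀ i i' j, i ≠ j → i' ≠ j → U i j → U i' j := by
    intro i i' j hij hij' h
    by_cases hii : i = i'
    · exact hii ▸ h
    · refine (hUD i' j hij').resolve_right fun h' => ?_
      exact hnonadj (.inl i) (.inl i') (by simpa using hii) Gk_not_adj_inl
        fun t ht => (h t ht).trans (h' t ht)
  have hrow : ∀ i j j', i ≠ j → i ≠ j' → U i j → U i j' := by
    intro i j j' hij hij' h
    by_cases hjj : j' = j
    · exact hjj ▸ h
    · refine (hUD i j' hij').resolve_right fun h' => ?_
      exact hnonadj (.inr j') (.inr j) (by simpa using hjj) Gk_not_adj_inr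
        fun t ht => (h' t ht).trans (h t ht)
  have hall : ∀ i j i' j', i ≠ j → i' ≠ j' → U i j → U i' j' := by
    intro i j i' j' hij hij' h
    by_cases h₁ : i = j'
    · obtain ⟨l, hl, hl'⟩ := exists_third hk i i'
      exact hrow i' l j' hl'.symm hij'
        (hcol i i' l hl.symm hl'.symm (hrow i j l hij hl.symm h))
    · exact hcol i i' j' h₁ hij' (hrow i j j' hij h₁ h)
  by_cases hex : ∃ i j, i ≠ j ∧ U i j
  · obtain ⟨i, j, hij, h⟩ := hex
    exact le_of_reversed (fun i t => T t (.inl i)) (fun i t => T t (.inr i))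
      (fun i' j' hij' => hall i j i' j' hij hij' h)
      (fun i => hrev (.inl i) (.inr i) (by simp) (hnadj i))
  · push Not at hex
    exact le_of_reversed (fun i t => T t (.inr i)) (fun i t => T t (.inl i))
      (fun i j hij => (hUD j i hij.symm).resolve_left (hex j i hij.symm))
      (fun i => hrev (.inr i) (.inl i) (by simp) fun h => hnadj i h.symm)

/-! ### The upper bound -/

theorem filter_eq_pair {L : List V} (hL : L.Nodup) {u v : V} (h : [u, v].Sublist L) :
    L.filter (fun z => decide (z = u ∨ z = v)) = [u, v] := by
  symm
  refine List.Sublist.eq_of_length_le ?_ ?_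
  · have := h.filter (fun z => decide (z = u ∨ z = v))
    simpa using this
  · exact ((hL.filter _).subperm fun z hz => by simpa using (List.mem_filter.1 hz).2).length_le

theorem alternate_flatMap {ι : Type*} {l : List ι} {Q : ι → List V} (hQ : ∀ i, (Q i).Nodup)
    {u v : V} (huv : u ≠ v) (h : ∀ i, [u, v].Sublist (Q i)) : Alternate (l.flatMap Q) u v := by
  change ((l.flatMap Q).filter (fun z => decide (z = u ∨ z = v))).IsChain (· ≠ ·)
  rw [List.filter_flatMap]
  simp only [fun i => filter_eq_pair (hQ i) (h i)]
  induction l with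
  | nil => simp
  | cons i l ih => cases l <;> simp_all [huv.symm]

theorem not_alternate_flatMap {ι : Type*} {l : List ι} {Q : ι → List V} {u v : V} (huv : u ≠ v)
    (hQ : ∀ i, (Q i).Nodup) (h : ∀ i, [u, v].Sublist (Q i) ∨ [v, u].Sublist (Q i))
    {i j : ι} (hi : i ∈ l) (hj : j ∈ l) (hui : [u, v].Sublist (Q i))
    (hvj : [v, u].Sublist (Q j)) : ¬ Alternate (l.flatMap Q) u v := by
  change ¬ ((l.flatMap Q).filter (fun z => decide (z = u ∨ z = v))).IsChain (· ≠ ·)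
  set F : ι → List V := fun i => (Q i).filter (fun z => decide (z = u ∨ z = v)) with hF
  have hFv : ∀ i, [v, u].Sublist (Q i) → F i = [v, u] := fun i hi => by
    simp only [hF, or_comm (b := _ = v)]
    exact filter_eq_pair (hQ i) hi
  have hcase : ∀ i, F i = [u, v] ∨ F i = [v, u] := fun i =>
    (h i).imp (fun hi => filter_eq_pair (hQ i) hi) (hFv i)
  rw [List.filter_flatMap]
  change ¬ (l.flatMap F).IsChain (· ≠ ·)
  intro hc
  have hconst : ∀ i ∈ l, ∀ j ∈ l, F i = F j := by
    clear hi hj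
    induction l with
    | nil => simp
    | cons a l ih =>
      rw [List.flatMap_cons] at hc
      have ih := ih hc.right_of_append
      cases l with
      | nil => simp
      | cons b l =>
        have hab : F a = F b := by
          rcases hcase a with ha | ha <;> rcases hcase b with hb | hb <;>
            simp_all
        grind
  have := hconst i hi j hj
  rw [hFv j hvj, show F i = [u, v] from filter_eq_pair (hQ i) hui] at this
  simp_all

theorem kUniform_flatMap {ι : Type*} {l : List ι} {Q : ι → List V} (hQ : ∀ i, (Q i).Nodup)
    (hmem : ∀ i v, v ∈ Q i) : KUniform l.length (l.flatMap Q) := fun v => by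
  simp [List.count_flatMap, Function.comp_def,
    fun i => List.count_eq_one_of_mem (hQ i) (hmem i v)]

/-- The indices in `Fin k` other than `i`. -/
def others {k : ℕ} (i : Fin k) : List (Fin k) := (List.finRange k).filter (· ≠ i)

/-- The linear extension of the standard example putting `i'` below `i`, preceded by the apex. -/
def block {k : ℕ} (i : Fin k) : List (Option (Fin k ⊕ Fin k)) :=
  none :: ((others i).map (fun j => some (.inl j)) ++
    ([some (.inr i), some (.inl i)] ++ (others i).map (fun j => some (.inr j))))

theorem mem_others {k : ℕ} {i j : Fin k} : j ∈ others i ↔ j ≠ i := by simp [others]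

theorem mem_block {k : ℕ} (i : Fin k) (v : Option (Fin k ⊕ Fin k)) : v ∈ block i := by
  rcases v with _ | j | j <;> simp [block, mem_others] <;> tauto

theorem nodup_others {k : ℕ} (i : Fin k) : (others i).Nodup := (List.nodup_finRange k).filter _

theorem nodup_block {k : ℕ} (i : Fin k) : (block i).Nodup := by
  have h₁ : ((others i).map fun j => (some (.inl j) : Option (Fin k ⊕ Fin k))).Nodup :=
    (nodup_others i).map fun a b h => by simpa using h
  have h₂ : ((others i).map fun j => (some (.inr j) : Option (Fin k ⊕ Fin k))).Nodup :=
    (nodup_others i).map fun a b h => by simpa using h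
  simp [block, List.nodup_append, h₁, h₂, mem_others]

theorem pair_sublist_append {V : Type*} {L L' : List V} {u v : V} (hu : u ∈ L) (hv : v ∈ L') :
    [u, v].Sublist (L ++ L') :=
  (List.singleton_sublist.2 hu).append (List.singleton_sublist.2 hv)

theorem pair_sublist_or {V : Type*} {L : List V} {u v : V} (huv : u ≠ v) (hu : u ∈ L) (hv : v ∈ L) :
    [u, v].Sublist L ∨ [v, u].Sublist L := by
  obtain ⟨s, t, rfl⟩ := List.append_of_mem hu
  rcases List.mem_append.1 hv with h | h
  · exact .inr (pair_sublist_append h (by simp))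
  · have h : v ∈ t := by simpa [huv.symm] using h
    exact .inl (((List.singleton_sublist.2 h).cons_cons u).trans (List.sublist_append_right _ _))

theorem block_none {k : ℕ} (i : Fin k) (v : Fin k ⊕ Fin k) :
    [none, some v].Sublist (block i) :=
  (List.singleton_sublist.2 (by simpa [block] using mem_block i (some v))).cons_cons _

theorem block_inl_inr {k : ℕ} (i : Fin k) {j l : Fin k} (hjl : j ≠ l) :
    [some (.inl j), some (.inr l)].Sublist (block i) := by
  refine .cons _ ?_
  by_cases hj : j = i
  · subst hj
    refine List.Sublist.trans ?_ (List.sublist_append_right _ _)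
    exact pair_sublist_append (by simp) (by simpa [mem_others] using hjl.symm)
  · exact pair_sublist_append (by simpa [mem_others] using hj)
      (by simp [mem_others]; tauto)

theorem block_inr_inl {k : ℕ} (i : Fin k) :
    [some (.inr i), some (.inl i)].Sublist (block i) :=
  .cons _ ((List.sublist_append_left _ _).trans (List.sublist_append_right _ _))

theorem block_inl_inr_self {k : ℕ} {i j : Fin k} (hij : i ≠ j) :
    [some (.inl i), some (.inr i)].Sublist (block j) :=
  .cons _ (pair_sublist_append (by simpa [mem_others] using hij)
    (by simp [mem_others, hij]))

theorem block_inl_inl {k : ℕ} {i j : Fin k} (hij : i ≠ j) :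
    [some (.inl i), some (.inl j)].Sublist (block j) :=
  .cons _ (pair_sublist_append (by simpa [mem_others] using hij) (by simp))

theorem block_inr_inr {k : ℕ} {i j : Fin k} (hij : i ≠ j) :
    [some (.inr i), some (.inr j)].Sublist (block i) := by
  refine .cons _ (List.Sublist.trans ?_ (List.sublist_append_right _ _))
  exact pair_sublist_append (by simp) (by simpa [mem_others] using hij.symm)

theorem kRepresentable_Gk {k : ℕ} (hk : 2 ≤ k) : KRepresentable (Gk k) k := by
  refine ⟨(List.finRange k).flatMap block, ?_, fun v => ?_, ?_⟩
  · simpa using kUniform_flatMap (l := List.finRange k) nodup_block mem_block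
  · exact List.mem_flatMap.2 ⟨⟨0, by omega⟩, List.mem_finRange _, mem_block _ v⟩
  have yes : ∀ {u v : Option (Fin k ⊕ Fin k)}, u ≠ v → (∀ i, [u, v].Sublist (block i)) →
      Alternate ((List.finRange k).flatMap block) u v := fun huv h =>
    alternate_flatMap nodup_block huv h
  have no : ∀ {u v : Option (Fin k ⊕ Fin k)} (i j : Fin k), u ≠ v → [u, v].Sublist (block i) →
      [v, u].Sublist (block j) → ¬ Alternate ((List.finRange k).flatMap block) u v :=
    fun i j huv hi hj => not_alternate_flatMap huv nodup_block
      (fun i => pair_sublist_or huv (mem_block i _) (mem_block i _))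
      (List.mem_finRange i) (List.mem_finRange j) hi hj
  have hlr : ∀ i j : Fin k, Alternate ((List.finRange k).flatMap block)
      (some (.inl i)) (some (.inr j)) ↔ (Gk k).Adj (some (.inl i)) (some (.inr j)) := by
    intro i j
    rw [Gk_adj_inl_inr]
    by_cases hij : i = j
    · subst hij
      have : Nontrivial (Fin k) := Fin.nontrivial_iff_two_le.2 hk
      obtain ⟨j, hj⟩ := exists_ne i
      exact iff_of_false (no j i (by simp) (block_inl_inr_self hj.symm) (block_inr_inl i))
        (by simp)
    · exact iff_of_true (yes (by simp) fun l => block_inl_inr l hij) hij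
  rintro (_ | i | i) (_ | j | j) huv
  · exact absurd rfl huv
  · exact iff_of_true (yes huv fun l => block_none l _) (Gk_adj_none _)
  · exact iff_of_true (yes huv fun l => block_none l _) (Gk_adj_none _)
  · exact iff_of_true (alternate_comm.1 (yes huv.symm fun l => block_none l _))
      (Gk_adj_none _).symm
  · have hij : i ≠ j := by simpa using huv
    exact iff_of_false (no j i huv (block_inl_inl hij) (block_inl_inl hij.symm)) Gk_not_adj_inl
  · exact hlr i j
  · exact iff_of_true (alternate_comm.1 (yes huv.symm fun l => block_none l _))
      (Gk_adj_none _).symm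
  · rw [alternate_comm, SimpleGraph.adj_comm]
    exact hlr j i
  · have hij : i ≠ j := by simpa using huv
    exact iff_of_false (no i j huv (block_inr_inr hij) (block_inr_inr hij.symm)) Gk_not_adj_inr

end WordRep

/-- For every `k ≥ 2`, the graph `G_k`, obtained from the crown graph `H_{k,k}` by adding
an all-adjacent vertex, is word-representable with representation number exactly `k`. -/
theorem Gk_representation_number_eq (k : ℕ) (hk : 2 ≤ k) :
    WordRepresentable (Gk k) ∧ reprNum (Gk k) = k := by
  have h := WordRep.kRepresentable_Gk hk
  refine ⟨h.imp fun w hw => hw.2, ?_⟩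
  exact IsLeast.csInf_eq ⟨h, fun m hm => WordRep.le_of_kRepresentable hk hm⟩
end

section
/- For every positive integer c, there exists a word-representable graph with representation number exactly 2 whose chromatic number is greater than c; that is, there is no constant c such that every graph with representation number 2 is c-colorable. -/
/-- Disjoint union of a clique on the nonzero vertices and the isolated vertex `0`. -/
def cliqueWithIsolated (m : ℕ) : SimpleGraph (Fin (m + 1)) where
  Adj x y := x ≠ y ∧ x ≠ 0 ∧ y ≠ 0
  symm := ⟨fun _ _ h => ⟨h.1.symm, h.2.2, h.2.1⟩⟩
  loopless := ⟨fun _ h => h.1 rfl⟩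

theorem List.Nodup.isChain_ne {α : Type*} {l : List α} (h : l.Nodup) :
    l.IsChain (· ≠ ·) :=
  List.Pairwise.isChain h

theorem List.Nodup.isChain_ne_append_self {α : Type*} {l : List α} (h : l.Nodup)
    {x y : α} (hxy : x ≠ y) (hx : x ∈ l) (hy : y ∈ l) :
    (l ++ l).IsChain (· ≠ ·) := by
  refine List.isChain_append.2 ⟨h.isChain_ne, h.isChain_ne, ?_⟩
  match l, h, hx, hy with
  | [a], _, hx, hy => simp_all
  | a :: b :: t, h, _, _ =>
    intro u hu v hv huv
    rw [List.getLast?_cons_cons] at hu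
    have hmem : u ∈ b :: t := List.mem_of_mem_getLast? hu
    simp only [List.head?_cons, Option.mem_def, Option.some.injEq] at hv
    subst hv huv
    exact (List.nodup_cons.1 h).1 hmem

theorem KRepresentable.adj_of_one {V : Type*} [DecidableEq V]
    {G : SimpleGraph V} (h : KRepresentable G 1) {x y : V} (hxy : x ≠ y) : G.Adj x y := by
  obtain ⟨w, hw, hr⟩ := h
  refine (hr.2 x y hxy).1 (List.Nodup.isChain_ne (List.Nodup.filter _ ?_))
  exact List.nodup_iff_count_le_one.2 fun v => (hw v).le

theorem reprNum_eq_two {V : Type*} [DecidableEq V] {G : SimpleGraph V}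
    (h : KRepresentable G 2) {x y : V} (hxy : x ≠ y) (hadj : ¬ G.Adj x y) :
    reprNum G = 2 := by
  have : Nonempty V := ⟨x⟩
  refine le_antisymm (Nat.sInf_le h) (le_csInf ⟨2, h⟩ fun k hk => ?_)
  have h0 : k ≠ 0 := KRepresentable.ne_zero hk
  have h1 : k ≠ 1 := by
    rintro rfl
    exact hadj (KRepresentable.adj_of_one hk hxy)
  omega

theorem cliqueWithIsolated_kRepresentable_two (m : ℕ) :
    KRepresentable (cliqueWithIsolated m) 2 := by
  obtain ⟨L, hL⟩ : ∃ L : List (Fin (m + 1)), L = (List.finRange m).map Fin.succ := ⟨_, rfl⟩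
  have hnd : L.Nodup := hL ▸ (List.nodup_finRange m).map (Fin.succ_injective m)
  have hmem (v : Fin (m + 1)) : v ∈ L ↔ v ≠ 0 := by
    rw [hL, ← Fin.exists_succ_eq]
    simp
  refine ⟨0 :: 0 :: (L ++ L), fun v => ?_, fun v => ?_, fun x y hxy => ?_⟩
  · by_cases hv : v = 0
    · subst hv
      have : L.count 0 = 0 := List.count_eq_zero.2 (by simp [hmem])
      simp [this]
    · have : L.count v = 1 := List.count_eq_one_of_mem hnd ((hmem v).2 hv)
      simp [this, Ne.symm hv]
  · by_cases hv : v = 0 <;> simp [hmem, hv]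
  · change List.IsChain _ _ ↔ x ≠ y ∧ x ≠ 0 ∧ y ≠ 0
    by_cases h0 : 0 = x ∨ 0 = y
    · rw [List.filter_cons_of_pos (by simpa using h0),
        List.filter_cons_of_pos (by simpa using h0)]
      simp only [List.isChain_cons_cons]
      grind
    · rw [List.filter_cons_of_neg (by simpa using h0),
        List.filter_cons_of_neg (by simpa using h0), List.filter_append]
      push Not at h0
      refine iff_of_true ?_ ⟨hxy, h0.1.symm, h0.2.symm⟩
      refine (hnd.filter _).isChain_ne_append_self hxy ?_ ?_
      · simp [hmem, h0.1.symm]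
      · simp [hmem, h0.2.symm]

theorem cliqueWithIsolated_not_colorable (c : ℕ) :
    ¬ (cliqueWithIsolated (c + 1)).Colorable c := by
  rintro ⟨C⟩
  have hinj : Function.Injective fun i : Fin (c + 1) => C i.succ := by
    intro i j hij
    by_contra hne
    exact C.valid (show (cliqueWithIsolated (c + 1)).Adj i.succ j.succ from
      ⟨fun h => hne (Fin.succ_injective _ h), Fin.succ_ne_zero i, Fin.succ_ne_zero j⟩) hij
  simpa using Fintype.card_le_of_injective _ hinj

/-- For every positive integer `c`, there is a word-representable graph with
representation number exactly 2 whose chromatic number exceeds `c`: no constant `c`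
makes all graphs of representation number 2 `c`-colorable. -/
theorem R2_not_c_colorable (c : ℕ) (hc : 0 < c) :
    ∃ (n : ℕ) (G : SimpleGraph (Fin n)),
      WordRepresentable G ∧ reprNum G = 2 ∧ ¬ G.Colorable c := by
  have h2 := cliqueWithIsolated_kRepresentable_two (c + 1)
  refine ⟨_, cliqueWithIsolated (c + 1), ?_,
    reprNum_eq_two h2 (x := 0) (y := 1) (by simp) fun h => h.2.1 rfl,
    cliqueWithIsolated_not_colorable c⟩
  obtain ⟨w, _, hw⟩ := h2
  exact ⟨w, hw⟩
end
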